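/- arXiv:1712.05445 — 2 statements merged into one kernel-verified Lean document; each statement's English description precedes it below -/
import Mathlib

section
/- Let θ, σ, T > 0, let α, ρ ∈ ℝ, and let (ν_k)_{k≥1}, (q_k)_{k≥1} be sequences of positive reals with ν_k → ∞ and q_k → 0. Assume (i) there exists M ∈ ℝ with ν_n^{α−1} q_n^{2ρ+2} ≤ M for all n ≥ 1, (ii) Σ_{k≥1} ν_k^{α} q_k^{2ρ+2} = ∞, and (iii) Σ_{k≥1} ν_k^{2α−1} q_k^{4ρ+4} = ∞. Let (u_k)_{k≥1} be independent (θ, σ, ν_k, q_k)-Ornstein–Uhlenbeck processes with zero initial condition and continuous sample paths, and define θ̂_N := −[Σ_{k=1}^{N} ν_k^{α} q_k^{2ρ} (u_k(T)² − σ² q_k² T)] / [2 Σ_{k=1}^{N} ν_k^{1+α} q_k^{2ρ} ∫_0^T u_k(t)² dt]. Then the random variables [Σ_{k=1}^{N} ν_k^{α} q_k^{2ρ+2} / (Σ_{k=1}^{N} ν_k^{2α−1} q_k^{4ρ+4})^{1/2}] · (θ̂_N − θ) converge in distribution, as N → ∞, to a centered Gaussian law with variance 2θ/T. -/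
open MeasureTheory ProbabilityTheory Real Filter

noncomputable section

/-- A finite random vector `X` is centered Gaussian with covariance matrix `C`:
every linear combination of its coordinates is a centered real Gaussian with the
corresponding variance. -/
def IsCenteredGaussianVec {Ω : Type*} [MeasurableSpace Ω] (P : Measure Ω)
    {n : ℕ} (X : Fin n → Ω → ℝ) (C : Fin n → Fin n → ℝ) : Prop :=
  ∀ a : Fin n → ℝ,
    Measure.map (fun ω => ∑ i, a i * X i ω) P
      = gaussianReal 0 (∑ i, ∑ j, a i * a j * C i j).toNNReal

/-- Covariance function of the `(θ, σ, ν, q)`-Ornstein–Uhlenbeck process with zero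
initial condition. -/
def ouCov (θ σ ν q s t : ℝ) : ℝ :=
  (σ ^ 2 * q ^ 2 / (2 * θ * ν)) *
    (Real.exp (-(θ * ν * |t - s|)) - Real.exp (-(θ * ν * (t + s))))

/-- The family `u k`, `k ∈ ℕ`, consists of independent `(θ, σ, ν k, q k)`-Ornstein–Uhlenbeck
processes with zero initial condition on `[0, T]`: any finite collection of values of the
processes is jointly centered Gaussian, with OU covariances within each process and zero
cross-covariances between distinct processes. -/
def IsIndepOUFamily {Ω : Type*} [MeasurableSpace Ω] (P : Measure Ω)
    (u : ℕ → ℝ → Ω → ℝ) (θ σ : ℝ) (ν q : ℕ → ℝ) (T : ℝ) : Prop :=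
  ∀ (n : ℕ) (k : Fin n → ℕ) (t : Fin n → ℝ), (∀ i, t i ∈ Set.Icc (0 : ℝ) T) →
    IsCenteredGaussianVec P (fun i ω => u (k i) (t i) ω)
      (fun i j => if k i = k j then ouCov θ σ (ν (k i)) (q (k i)) (t i) (t j) else 0)

lemma norm_prod_sub_prod_le_sum {ι : Type*} (s : Finset ι) (f g : ι → ℂ)
    (hf : ∀ i ∈ s, ‖f i‖ ≤ 1) (hg : ∀ i ∈ s, ‖g i‖ ≤ 1) :
    ‖∏ i ∈ s, f i - ∏ i ∈ s, g i‖ ≤ ∑ i ∈ s, ‖f i - g i‖ := by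
  classical
  induction s using Finset.induction_on with
  | empty => simp
  | insert a s ha ih =>
    rw [Finset.prod_insert ha, Finset.prod_insert ha, Finset.sum_insert ha]
    have hs := ih (fun i hi => hf i (Finset.mem_insert_of_mem hi))
      (fun i hi => hg i (Finset.mem_insert_of_mem hi))
    have hP : ‖∏ i ∈ s, f i‖ ≤ 1 := by
      rw [norm_prod]
      exact Finset.prod_le_one (fun i _ => norm_nonneg _)
        (fun i hi => hf i (Finset.mem_insert_of_mem hi))
    have e : f a * ∏ i ∈ s, f i - g a * ∏ i ∈ s, g i
        = (f a - g a) * ∏ i ∈ s, f i + g a * (∏ i ∈ s, f i - ∏ i ∈ s, g i) := by ring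
    rw [e]
    refine (norm_add_le _ _).trans (add_le_add ?_ ?_)
    · rw [norm_mul]; exact mul_le_of_le_one_right (norm_nonneg _) hP
    · rw [norm_mul]
      exact (mul_le_of_le_one_left (norm_nonneg _) (hg a (Finset.mem_insert_self _ _))).trans hs

lemma norm_exp_mul_I_sub_quadratic_le (x : ℝ) :
    ‖Complex.exp (x * Complex.I) - (1 + x * Complex.I - x ^ 2 / 2)‖ ≤ 4 * |x| ^ 3 := by
  have hn : ‖(x : ℂ) * Complex.I‖ = |x| := by simp
  rcases le_total |x| 1 with h | h
  · have := Complex.norm_exp_sub_sum_le_norm_mul_exp (x * Complex.I) 3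
    rw [hn] at this
    simp only [Finset.sum_range_succ, Finset.sum_range_zero, mul_pow, Complex.I_sq] at this
    norm_num at this
    have e : Complex.exp (x * Complex.I) - (1 + x * Complex.I - x ^ 2 / 2)
      = Complex.exp (x * Complex.I) - (1 + x * Complex.I + -(x:ℂ) ^ 2 / 2) := by ring
    rw [e]
    have h3 : rexp |x| ≤ 4 := by
      have := Real.exp_le_exp.2 h
      have := Real.exp_one_lt_d9
      linarith
    have h4 : 0 ≤ |x| ^ 3 := by positivity
    nlinarith
  · have t1 := norm_sub_le (Complex.exp (x * Complex.I)) (1 + x * Complex.I - x ^ 2 / 2)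
    have t2 := norm_sub_le (1 + x * Complex.I) ((x : ℂ) ^ 2 / 2)
    have t3 := norm_add_le (1 : ℂ) (x * Complex.I)
    rw [Complex.norm_exp_ofReal_mul_I] at t1
    rw [hn, norm_one] at t3
    have t4 : ‖(x : ℂ) ^ 2 / 2‖ = |x| ^ 2 / 2 := by simp
    have := pow_le_pow_right₀ h (show 2 ≤ 3 by norm_num)
    have := pow_le_pow_right₀ h (show 1 ≤ 3 by norm_num)
    have := pow_le_pow_right₀ h (show 0 ≤ 3 by norm_num)
    linarith

lemma abs_exp_neg_sq_sub_le (x : ℝ) : |rexp (-x ^ 2) - (1 - x ^ 2)| ≤ |x| ^ 3 := by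
  have h1 : 1 - x ^ 2 ≤ rexp (-x ^ 2) := by linarith [Real.add_one_le_exp (-x ^ 2)]
  rw [abs_of_nonneg (by linarith)]
  rcases le_total |x| 1 with h | h
  · have h2 : rexp (-x ^ 2) ≤ 1 / (1 + x ^ 2) := by
      rw [Real.exp_neg, one_div]
      exact inv_anti₀ (by positivity) (by linarith [Real.add_one_le_exp (x ^ 2)])
    have h3 : 1 / (1 + x ^ 2) ≤ 1 - x ^ 2 + x ^ 4 := by
      rw [div_le_iff₀ (by positivity)]
      nlinarith [sq_nonneg (x ^ 3)]
    have h4 : x ^ 4 ≤ |x| ^ 3 := by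
      have : x ^ 4 = |x| ^ 4 := by rw [pow_abs, abs_of_nonneg]; positivity
      rw [this]
      exact pow_le_pow_of_le_one (abs_nonneg _) h (by norm_num)
    linarith
  · have h2 : rexp (-x ^ 2) ≤ 1 := Real.exp_le_one_iff.2 (by nlinarith)
    have h3 : x ^ 2 = |x| ^ 2 := (sq_abs x).symm
    have := pow_le_pow_right₀ h (show 2 ≤ 3 by norm_num)
    linarith

lemma integral_pow_four_gaussianReal : ∫ x, x ^ 4 ∂(gaussianReal 0 1) = 3 := by
  have h := iteratedDeriv_mgf_zero (X := id) (μ := gaussianReal 0 1) (by simp [integrableExpSet_id_gaussianReal]) 4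
  have e : mgf id (gaussianReal 0 1) = fun t => rexp (t ^ 2 / 2) := by
    rw [mgf_id_gaussianReal]; ext t; simp
  simp only [Pi.pow_apply, id] at h
  rw [← h, e]
  have h0 (t : ℝ) : HasDerivAt (fun t : ℝ => rexp (t ^ 2 / 2)) (t * rexp (t ^ 2 / 2)) t := by
    convert ((hasDerivAt_pow 2 t).div_const 2).exp using 1
    simp; ring
  have d1 : deriv (fun t : ℝ => rexp (t ^ 2 / 2)) = fun t => t * rexp (t ^ 2 / 2) :=
    funext fun t => (h0 t).deriv
  have d2 : deriv (fun t : ℝ => t * rexp (t ^ 2 / 2)) = fun t => (1 + t ^ 2) * rexp (t ^ 2 / 2) :=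
    funext fun t => by rw [((hasDerivAt_id' t).fun_mul (h0 t)).deriv]; ring
  have d3 : deriv (fun t : ℝ => (1 + t ^ 2) * rexp (t ^ 2 / 2))
      = fun t => (3 * t + t ^ 3) * rexp (t ^ 2 / 2) :=
    funext fun t => by
      rw [(((hasDerivAt_pow 2 t).const_add 1).fun_mul (h0 t)).deriv]; simp; ring
  rw [iteratedDeriv_succ', iteratedDeriv_succ', iteratedDeriv_succ', iteratedDeriv_one, d1, d2, d3]
  rw [((((hasDerivAt_id' (0:ℝ)).const_mul 3).fun_add (hasDerivAt_pow 3 0)).fun_mul (h0 0)).deriv]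
  simp

lemma integral_sq_gaussianReal (v : NNReal) : ∫ x, x ^ 2 ∂(gaussianReal 0 v) = v := by
  have := variance_id_gaussianReal (μ := 0) (v := v)
  rw [variance_eq_integral (by fun_prop)] at this
  simpa using this

lemma integrable_pow_gaussianReal (n : ℕ) (v : NNReal) : Integrable (fun x => x ^ n) (gaussianReal 0 v) := by
  have := (memLp_id_gaussianReal (μ := 0) (v := v) n).integrable_norm_pow'
  refine (integrable_norm_iff (by fun_prop)).1 ?_
  simpa using this

/-- The third absolute moment constant in the expansion of the characteristic function of a
centered squared Gaussian. -/
def gaussSqConst : ℝ := 4 * ∫ x, |x ^ 2 - 1| ^ 3 ∂(gaussianReal 0 1) + 1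

lemma gaussSqConst_nonneg : 0 ≤ gaussSqConst := by
  have : 0 ≤ ∫ x, |x ^ 2 - 1| ^ 3 ∂(gaussianReal 0 1) :=
    integral_nonneg fun x => by positivity
  unfold gaussSqConst
  linarith

lemma integrable_abs_sq_sub_one_pow_three :
    Integrable (fun x : ℝ => |x ^ 2 - 1| ^ 3) (gaussianReal 0 1) := by
  have : Integrable (fun x : ℝ => x ^ 6 - 3 * x ^ 4 + 3 * x ^ 2 - 1) (gaussianReal 0 1) :=
    ((((integrable_pow_gaussianReal 6 1).sub ((integrable_pow_gaussianReal 4 1).const_mul 3)).add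
      ((integrable_pow_gaussianReal 2 1).const_mul 3)).sub (integrable_const 1))
  refine this.abs.congr (ae_of_all _ fun x => ?_)
  simp only
  rw [pow_abs]
  congr 1
  ring

lemma norm_integral_exp_sq_standard_sub_le (y : ℝ) :
    ‖∫ x, Complex.exp (((y * (x ^ 2 - 1) : ℝ) : ℂ) * Complex.I) ∂(gaussianReal 0 1)
      - (rexp (-y ^ 2) : ℂ)‖ ≤ gaussSqConst * |y| ^ 3 := by
  set μ := gaussianReal 0 1
  have i2 : Integrable (fun x : ℝ => x ^ 2 - 1) μ :=
    (integrable_pow_gaussianReal 2 1).sub (integrable_const 1)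
  have i4 : Integrable (fun x : ℝ => (x ^ 2 - 1) ^ 2) μ := by
    have : Integrable (fun x : ℝ => x ^ 4 - 2 * x ^ 2 + 1) μ :=
      ((integrable_pow_gaussianReal 4 1).sub ((integrable_pow_gaussianReal 2 1).const_mul 2)).add
        (integrable_const 1)
    exact this.congr (ae_of_all _ fun x => by simp only; ring)
  have e2 : ∫ x, (x ^ 2 - 1) ∂μ = 0 := by
    rw [integral_sub (integrable_pow_gaussianReal 2 1) (integrable_const 1),
      integral_sq_gaussianReal]
    simp
  have e4 : ∫ x, (x ^ 2 - 1) ^ 2 ∂μ = 2 := by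
    have : ∀ x : ℝ, (x ^ 2 - 1) ^ 2 = x ^ 4 - 2 * x ^ 2 + 1 := fun x => by ring
    have i : Integrable (fun x : ℝ => x ^ 4 - 2 * x ^ 2) μ :=
      (integrable_pow_gaussianReal 4 1).sub ((integrable_pow_gaussianReal 2 1).const_mul 2)
    simp_rw [this]
    rw [integral_add i (integrable_const 1),
      integral_sub (integrable_pow_gaussianReal 4 1)
      ((integrable_pow_gaussianReal 2 1).const_mul 2), integral_const_mul,
      integral_sq_gaussianReal, integral_pow_four_gaussianReal]
    norm_num
  have iE : Integrable (fun x : ℝ => Complex.exp (((y * (x ^ 2 - 1) : ℝ) : ℂ) * Complex.I)) μ := by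
    refine Integrable.of_bound (C := 1) (by fun_prop) (ae_of_all _ fun x => ?_)
    rw [Complex.norm_exp_ofReal_mul_I]
  have iQ1 : Integrable (fun x : ℝ => (1 : ℂ) + ((y * (x ^ 2 - 1) : ℝ) : ℂ) * Complex.I) μ :=
    (integrable_const _).add ((i2.const_mul y).ofReal.mul_const _)
  have iQ2 : Integrable (fun x : ℝ => ((y * (x ^ 2 - 1) : ℝ) : ℂ) ^ 2 / 2) μ := by
    have : Integrable (fun x : ℝ => ((y ^ 2 * (x ^ 2 - 1) ^ 2 : ℝ) : ℂ)) μ :=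
      (i4.const_mul (y ^ 2)).ofReal
    refine (this.div_const 2).congr (ae_of_all _ fun x => ?_)
    push_cast; ring
  have eQ : ∫ x : ℝ, ((1 : ℂ) + ((y * (x ^ 2 - 1) : ℝ) : ℂ) * Complex.I
      - ((y * (x ^ 2 - 1) : ℝ) : ℂ) ^ 2 / 2) ∂μ = ((1 - y ^ 2 : ℝ) : ℂ) := by
    rw [integral_sub iQ1 iQ2, integral_add (integrable_const _)
      ((i2.const_mul y).ofReal.mul_const _), integral_mul_const, integral_complex_ofReal,
      integral_const_mul, e2, integral_div]
    have : ∀ x : ℝ, ((y * (x ^ 2 - 1) : ℝ) : ℂ) ^ 2 = ((y ^ 2 * (x ^ 2 - 1) ^ 2 : ℝ) : ℂ) :=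
      fun x => by push_cast; ring
    simp_rw [this]
    rw [integral_complex_ofReal, integral_const_mul, e4]
    simp
  have main : ‖∫ x, Complex.exp (((y * (x ^ 2 - 1) : ℝ) : ℂ) * Complex.I) ∂μ
      - ((1 - y ^ 2 : ℝ) : ℂ)‖ ≤ (4 * ∫ x, |x ^ 2 - 1| ^ 3 ∂μ) * |y| ^ 3 := by
    have iQ : Integrable (fun x : ℝ => (1 : ℂ) + ((y * (x ^ 2 - 1) : ℝ) : ℂ) * Complex.I
      - ((y * (x ^ 2 - 1) : ℝ) : ℂ) ^ 2 / 2) μ := iQ1.sub iQ2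
    rw [← eQ, ← integral_sub iE iQ]
    refine (norm_integral_le_integral_norm _).trans ?_
    rw [mul_right_comm, ← integral_const_mul]
    refine integral_mono_of_nonneg (ae_of_all _ fun x => norm_nonneg _)
      (integrable_abs_sq_sub_one_pow_three.const_mul _) (ae_of_all _ fun x => ?_)
    refine (norm_exp_mul_I_sub_quadratic_le _).trans (le_of_eq ?_)
    rw [abs_mul]; ring
  have hy := abs_exp_neg_sq_sub_le y
  have e : ∀ z : ℂ, z - (rexp (-y ^ 2) : ℂ)
      = (z - ((1 - y ^ 2 : ℝ) : ℂ)) - ((rexp (-y ^ 2) - (1 - y ^ 2) : ℝ) : ℂ) := fun z => by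
    push_cast; ring
  rw [e]
  refine (norm_sub_le _ _).trans ((add_le_add main (?_ : _ ≤ |y| ^ 3)).trans (le_of_eq ?_))
  · rw [Complex.norm_real]; exact hy
  · unfold gaussSqConst; ring

lemma norm_integral_exp_sq_gaussianReal_sub_le (v : NNReal) (s : ℝ) :
    ‖∫ x, Complex.exp (((s * (x ^ 2 - v) : ℝ) : ℂ) * Complex.I) ∂(gaussianReal 0 v)
      - (rexp (-(s * v) ^ 2) : ℂ)‖ ≤ gaussSqConst * |s * v| ^ 3 := by
  have hm : gaussianReal 0 v = (gaussianReal 0 1).map (fun x => √(v : ℝ) * x) := by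
    rw [gaussianReal_map_const_mul]
    congr 1
    · simp
    · ext; simp
  rw [hm, integral_map (by fun_prop) (by fun_prop)]
  convert norm_integral_exp_sq_standard_sub_le (s * v) using 6 with x
  rw [mul_pow, Real.sq_sqrt v.coe_nonneg]
  ring_nf

lemma exists_orthogonal_diagonalization {ι : Type*} [Fintype ι] [DecidableEq ι]
    (A : Matrix ι ι ℝ) (hA : A.IsSymm) :
    ∃ (U : Matrix ι ι ℝ) (l : ι → ℝ), U.transpose * U = 1 ∧ U * U.transpose = 1 ∧
      U.transpose * A * U = Matrix.diagonal l := by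
  have hH : A.IsHermitian := by
    rw [Matrix.IsHermitian, Matrix.conjTranspose_eq_transpose_of_trivial]; exact hA
  have hs : (star (hH.eigenvectorUnitary : Matrix ι ι ℝ))
      = (hH.eigenvectorUnitary : Matrix ι ι ℝ).transpose := by
    rw [Matrix.star_eq_conjTranspose, Matrix.conjTranspose_eq_transpose_of_trivial]
  refine ⟨hH.eigenvectorUnitary, hH.eigenvalues, ?_, ?_, ?_⟩
  · rw [← hs]; exact Unitary.coe_star_mul_self _
  · rw [← hs]; exact Unitary.coe_mul_star_self _
  · have := hH.conjStarAlgAut_star_eigenvectorUnitary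
    rw [Unitary.conjStarAlgAut_star_apply] at this
    rw [← hs]
    simpa using this

lemma sum_sum_mul_eq_dotProduct {ι : Type*} [Fintype ι] (A : Matrix ι ι ℝ) (x : ι → ℝ) :
    ∑ i, ∑ j, x i * x j * A i j = x ⬝ᵥ (A.mulVec x) := by
  simp only [dotProduct, Matrix.mulVec, Finset.mul_sum]
  exact Finset.sum_congr rfl fun i _ => Finset.sum_congr rfl fun j _ => by ring

lemma norm_integral_exp_centered_normSq_sub_le {Ω ι : Type*} [MeasurableSpace Ω] {P : Measure Ω}
    [IsProbabilityMeasure P] [Fintype ι] (Y : ι → Ω → ℝ) (A : Matrix ι ι ℝ) (hA : A.IsSymm) {Λ : ℝ}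
    (hpos : ∀ x : ι → ℝ, 0 ≤ ∑ i, ∑ j, x i * x j * A i j)
    (hle : ∀ x : ι → ℝ, ∑ i, ∑ j, x i * x j * A i j ≤ Λ * ∑ i, x i ^ 2)
    (hY : ∀ a : ι → ℝ, P.map (fun ω => ∑ i, a i * Y i ω)
      = gaussianReal 0 (∑ i, ∑ j, a i * a j * A i j).toNNReal) (s : ℝ) :
    ‖∫ ω, Complex.exp (((s * (∑ i, Y i ω ^ 2 - ∑ i, A i i) : ℝ) : ℂ) * Complex.I) ∂P
      - (rexp (-(s ^ 2 * ∑ i, ∑ j, A i j ^ 2)) : ℂ)‖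
      ≤ gaussSqConst * |s| ^ 3 * Λ * ∑ i, ∑ j, A i j ^ 2 := by
  classical
  obtain ⟨U, l, hUU, hUU', hd⟩ := exists_orthogonal_diagonalization A hA
  have hquad (b : ι → ℝ) :
      ∑ i, ∑ j, U.mulVec b i * U.mulVec b j * A i j = ∑ a, l a * b a ^ 2 := by
    rw [sum_sum_mul_eq_dotProduct, Matrix.mulVec_mulVec, Matrix.dotProduct_mulVec,
      ← Matrix.vecMul_transpose, Matrix.vecMul_vecMul, ← Matrix.dotProduct_mulVec,
      ← Matrix.mul_assoc, hd]
    simp only [dotProduct, Matrix.mulVec_diagonal]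
    exact Finset.sum_congr rfl fun _ _ => by ring
  have hnorm (b : ι → ℝ) : ∑ i, U.mulVec b i ^ 2 = ∑ i, b i ^ 2 := by
    have h1 : U.mulVec b ⬝ᵥ U.mulVec b = b ⬝ᵥ b := by
      rw [Matrix.dotProduct_mulVec, ← Matrix.vecMul_transpose, Matrix.vecMul_vecMul,
        ← Matrix.dotProduct_mulVec, hUU, Matrix.one_mulVec]
    simpa [dotProduct, sq] using h1
  have hl0 (a : ι) : 0 ≤ l a := by
    have := hpos (U.mulVec (Pi.single a 1))
    rw [hquad] at this
    simpa [Pi.single_apply] using this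
  have hlΛ (a : ι) : l a ≤ Λ := by
    have := hle (U.mulVec (Pi.single a 1))
    rw [hquad, hnorm] at this
    simpa [Pi.single_apply] using this
  have hAd : A = U * Matrix.diagonal l * U.transpose := by
    rw [← hd]
    calc A = (U * U.transpose) * A * (U * U.transpose) := by rw [hUU']; simp
      _ = _ := by simp only [Matrix.mul_assoc]
  have htr : ∑ i, A i i = ∑ a, l a := by
    have : A.trace = (Matrix.diagonal l).trace := by
      conv_lhs => rw [hAd]
      rw [Matrix.trace_mul_comm, ← Matrix.mul_assoc, hUU, Matrix.one_mul]
    simpa [Matrix.trace] using this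
  have htr2 : ∑ i, ∑ j, A i j ^ 2 = ∑ a, l a ^ 2 := by
    have h1 : (A * A).trace = (Matrix.diagonal l * Matrix.diagonal l).trace := by
      conv_lhs => rw [hAd]
      rw [show U * Matrix.diagonal l * U.transpose * (U * Matrix.diagonal l * U.transpose)
        = U * (Matrix.diagonal l * (U.transpose * U) * Matrix.diagonal l * U.transpose) by
          simp only [Matrix.mul_assoc], hUU, Matrix.mul_one, Matrix.trace_mul_comm,
          Matrix.mul_assoc, hUU, Matrix.mul_one]
    have h2 : (A * A).trace = ∑ i, ∑ j, A i j ^ 2 := by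
      simp only [Matrix.trace, Matrix.diag, Matrix.mul_apply]
      refine Finset.sum_congr rfl fun i _ => Finset.sum_congr rfl fun j _ => ?_
      rw [hA.apply i j, sq]
    rw [← h2, h1]
    simp [Matrix.trace, Matrix.diagonal_mul_diagonal, sq]
  set W : ι → Ω → ℝ := fun a ω => ∑ i, U i a * Y i ω with hW
  have hWsq (ω : Ω) : ∑ a, W a ω ^ 2 = ∑ i, Y i ω ^ 2 := by
    have h1 : (U.transpose.mulVec fun i => Y i ω) ⬝ᵥ (U.transpose.mulVec fun i => Y i ω)
        = (fun i => Y i ω) ⬝ᵥ (fun i => Y i ω) := by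
      rw [Matrix.dotProduct_mulVec, ← Matrix.vecMul_transpose, Matrix.vecMul_vecMul,
        ← Matrix.dotProduct_mulVec, Matrix.transpose_transpose, hUU', Matrix.one_mulVec]
    simpa [dotProduct, sq, Matrix.mulVec] using h1
  have hWlaw (b : ι → ℝ) : P.map (fun ω => ∑ a, b a * W a ω)
      = gaussianReal 0 (∑ a, l a * b a ^ 2).toNNReal := by
    rw [← hquad, ← hY]
    congr 1
    ext ω
    simp only [hW, Matrix.mulVec, dotProduct, Finset.mul_sum, Finset.sum_mul]
    rw [Finset.sum_comm]
    exact Finset.sum_congr rfl fun _ _ => Finset.sum_congr rfl fun _ _ => by ring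
  have hWa (a : ι) : P.map (W a) = gaussianReal 0 (l a).toNNReal := by
    have := hWlaw (Pi.single a 1)
    simpa [Pi.single_apply] using this
  have hWm (a : ι) : AEMeasurable (W a) P := by
    refine AEMeasurable.of_map_ne_zero ?_
    rw [hWa]
    exact IsProbabilityMeasure.ne_zero _
  have hind : iIndepFun W P := by
    rw [iIndepFun_iff_charFun_pi hWm]
    intro t
    have e1 : charFun (P.map (fun ω => WithLp.toLp 2 (W · ω))) t
        = charFun (P.map (fun ω => ∑ a, t a * W a ω)) 1 := by
      rw [charFun_apply, charFun_apply_real, integral_map (by fun_prop) (by fun_prop),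
        integral_map (by fun_prop) (by fun_prop)]
      congr 1 with ω
      simp [PiLp.inner_apply]
    rw [e1, hWlaw, charFun_gaussianReal]
    simp_rw [hWa, charFun_gaussianReal]
    rw [← Complex.exp_sum]
    congr 1
    rw [Real.coe_toNNReal _ (Finset.sum_nonneg fun a _ => mul_nonneg (hl0 a) (sq_nonneg _))]
    simp only [Real.coe_toNNReal _ (hl0 _)]
    push_cast
    simp [Finset.sum_div]
  have hind2 : iIndepFun (fun a ω => W a ω ^ 2 - l a) P :=
    hind.comp (fun a x => x ^ 2 - l a) (fun a => by fun_prop)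
  have hfac : ∫ ω, Complex.exp (((s * (∑ i, Y i ω ^ 2 - ∑ i, A i i) : ℝ) : ℂ) * Complex.I) ∂P
      = ∏ a, ∫ x, Complex.exp (((s * (x ^ 2 - (l a).toNNReal) : ℝ) : ℂ) * Complex.I)
        ∂(gaussianReal 0 (l a).toNNReal) := by
    have h1 := congrFun (hind2.charFun_map_fun_sum_eq_prod (fun a => by fun_prop)) s
    rw [Finset.prod_apply, charFun_apply_real, integral_map (by fun_prop) (by fun_prop)] at h1
    simp_rw [← hWsq, htr, ← Finset.sum_sub_distrib]
    push_cast at h1 ⊢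
    rw [h1]
    refine Finset.prod_congr rfl fun a _ => ?_
    rw [charFun_apply_real, integral_map (by fun_prop) (by fun_prop), ← hWa,
      integral_map (hWm a) (by fun_prop)]
    simp [Real.coe_toNNReal _ (hl0 a)]
  have hexp : (rexp (-(s ^ 2 * ∑ i, ∑ j, A i j ^ 2)) : ℂ)
      = ∏ a, (rexp (-(s * (l a).toNNReal) ^ 2) : ℂ) := by
    rw [htr2, ← Complex.ofReal_prod, ← Real.exp_sum]
    congr 2
    rw [Finset.mul_sum, ← Finset.sum_neg_distrib]
    exact Finset.sum_congr rfl fun a _ => by rw [Real.coe_toNNReal _ (hl0 a)]; ring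
  rw [hfac, hexp]
  refine (norm_prod_sub_prod_le_sum _ _ _ (fun a _ => ?_) (fun a _ => ?_)).trans ?_
  · refine (norm_integral_le_integral_norm _).trans ?_
    simp only [Complex.norm_exp_ofReal_mul_I]
    simp
  · rw [Complex.norm_real, Real.norm_of_nonneg (Real.exp_pos _).le]
    exact Real.exp_le_one_iff.2 (by nlinarith [sq_nonneg (s * (l a).toNNReal)])
  · rw [htr2, Finset.mul_sum]
    refine Finset.sum_le_sum fun a _ => (norm_integral_exp_sq_gaussianReal_sub_le _ s).trans ?_
    rw [Real.coe_toNNReal _ (hl0 a), abs_mul, abs_of_nonneg (hl0 a)]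
    have hc : 0 ≤ gaussSqConst * |s| ^ 3 * l a ^ 2 :=
      mul_nonneg (mul_nonneg gaussSqConst_nonneg (by positivity)) (sq_nonneg _)
    nlinarith [mul_le_mul_of_nonneg_left (hlΛ a) hc]

lemma norm_integral_exp_centered_weighted_sub_le {Ω ι : Type*} [MeasurableSpace Ω] {P : Measure Ω}
    [IsProbabilityMeasure P] [Fintype ι] (X : ι → Ω → ℝ) (C : ι → ι → ℝ) (w : ι → ℝ)
    (hw : ∀ i, 0 ≤ w i) (hC : ∀ i j, C i j = C j i) {Λ : ℝ}
    (hpos : ∀ x : ι → ℝ, 0 ≤ ∑ i, ∑ j, x i * x j * C i j)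
    (hle : ∀ i, ∑ j, w j * |C i j| ≤ Λ)
    (hX : ∀ a : ι → ℝ, P.map (fun ω => ∑ i, a i * X i ω)
      = gaussianReal 0 (∑ i, ∑ j, a i * a j * C i j).toNNReal) (s : ℝ) :
    ‖∫ ω, Complex.exp (((s * (∑ i, w i * X i ω ^ 2 - ∑ i, w i * C i i) : ℝ) : ℂ)
        * Complex.I) ∂P
      - (rexp (-(s ^ 2 * ∑ i, ∑ j, w i * w j * C i j ^ 2)) : ℂ)‖
      ≤ gaussSqConst * |s| ^ 3 * Λ * ∑ i, ∑ j, w i * w j * C i j ^ 2 := by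
  have hsq (i : ι) : √(w i) ^ 2 = w i := Real.sq_sqrt (hw i)
  have := norm_integral_exp_centered_normSq_sub_le (P := P) (Λ := Λ)
    (fun i ω => √(w i) * X i ω) (Matrix.of fun i j => √(w i) * √(w j) * C i j) ?_ ?_ ?_ ?_ s
  · simp only [Matrix.of_apply, mul_pow, hsq, ← sq] at this
    exact this
  · ext i j
    simp only [Matrix.transpose_apply, Matrix.of_apply, hC j i]
    ring
  · intro x
    refine (hpos (fun i => √(w i) * x i)).trans_eq ?_
    refine Finset.sum_congr rfl fun i _ => Finset.sum_congr rfl fun j _ => ?_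
    rw [Matrix.of_apply]
    ring
  · intro x
    have h1 (i j : ι) : x i * x j * (√(w i) * √(w j) * C i j)
        ≤ (w j * |C i j|) * x i ^ 2 / 2 + (w i * |C j i|) * x j ^ 2 / 2 := by
      have h2 : x i * x j * (√(w i) * √(w j) * C i j)
          ≤ |(√(w j) * x i) * (√(w i) * x j)| * |C i j| := by
        rw [← abs_mul]
        refine le_trans (le_of_eq ?_) (le_abs_self _)
        ring
      have h3 : |(√(w j) * x i) * (√(w i) * x j)| ≤ (w j * x i ^ 2 + w i * x j ^ 2) / 2 := by
        have e1 : w j * x i ^ 2 = (√(w j) * x i) ^ 2 := by rw [mul_pow, hsq]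
        have e2 : w i * x j ^ 2 = (√(w i) * x j) ^ 2 := by rw [mul_pow, hsq]
        rw [e1, e2, abs_mul, ← sq_abs (√(w j) * x i), ← sq_abs (√(w i) * x j)]
        nlinarith [sq_nonneg (|√(w j) * x i| - |√(w i) * x j|)]
      refine h2.trans ((mul_le_mul_of_nonneg_right h3 (abs_nonneg _)).trans (le_of_eq ?_))
      rw [hC j i]
      ring
    calc _ ≤ ∑ i, ∑ j, ((w j * |C i j|) * x i ^ 2 / 2 + (w i * |C j i|) * x j ^ 2 / 2) :=
          Finset.sum_le_sum fun i _ => Finset.sum_le_sum fun j _ => h1 i j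
      _ = ∑ i, (∑ j, w j * |C i j|) * x i ^ 2 := by
          simp only [Finset.sum_add_distrib]
          rw [Finset.sum_comm (f := fun i j => (w i * |C j i|) * x j ^ 2 / 2),
            ← Finset.sum_add_distrib]
          refine Finset.sum_congr rfl fun i _ => ?_
          rw [← Finset.sum_add_distrib, Finset.sum_mul]
          exact Finset.sum_congr rfl fun j _ => by ring
      _ ≤ _ := by
          rw [Finset.mul_sum]
          exact Finset.sum_le_sum fun i _ => mul_le_mul_of_nonneg_right (hle i) (sq_nonneg _)
  · intro a
    refine Eq.trans ?_ ((hX (fun i => √(w i) * a i)).trans ?_)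
    · congr 1
      exact funext fun ω => Finset.sum_congr rfl fun i _ => by ring
    · congr 2
      exact Finset.sum_congr rfl fun i _ => Finset.sum_congr rfl fun j _ => by
        rw [Matrix.of_apply]; ring

/-- Normalized covariance of an Ornstein–Uhlenbeck process with zero initial condition sampled on
a regular grid, with one-step decay `r`. -/
def arCov (r : ℝ) (i j : ℕ) : ℝ := r ^ ((i - j) + (j - i)) - r ^ (i + j)

/-- Weights of the quadratic form `u_m ^ 2 + (1 - r ^ 2) * ∑ i < m, u_i ^ 2`. -/
def arWeight (r : ℝ) (m i : ℕ) : ℝ := if i < m then 1 - r ^ 2 else 1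

lemma arCov_comm (r : ℝ) (i j : ℕ) : arCov r i j = arCov r j i := by
  unfold arCov
  rw [add_comm (i - j), add_comm i j]

lemma arCov_self (r : ℝ) (i : ℕ) : arCov r i i = 1 - r ^ (2 * i) := by
  simp [arCov, two_mul]

lemma arCov_succ (r : ℝ) {i j : ℕ} (h : i ≤ j) : arCov r i (j + 1) = r * arCov r i j := by
  unfold arCov
  rw [show i - (j + 1) + (j + 1 - i) = (i - j + (j - i)) + 1 by omega, ← add_assoc]
  ring

lemma arCov_nonneg {r : ℝ} (h0 : 0 ≤ r) (h1 : r ≤ 1) (i j : ℕ) : 0 ≤ arCov r i j :=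
  sub_nonneg.2 (pow_le_pow_of_le_one h0 h1 (by omega))

lemma arCov_le {r : ℝ} (h0 : 0 ≤ r) (i j : ℕ) : arCov r i j ≤ r ^ ((i - j) + (j - i)) :=
  sub_le_self _ (pow_nonneg h0 _)

lemma sum_arWeight_mul (r : ℝ) (m : ℕ) (f : ℕ → ℝ) :
    ∑ i ∈ Finset.range (m + 1), arWeight r m i * f i
      = (1 - r ^ 2) * ∑ i ∈ Finset.range m, f i + f m := by
  rw [Finset.sum_range_succ, Finset.mul_sum]
  congr 1
  · exact Finset.sum_congr rfl fun i hi => by simp [arWeight, Finset.mem_range.1 hi]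
  · simp [arWeight]

lemma arWeight_nonneg {r : ℝ} (h0 : 0 ≤ r) (h1 : r ≤ 1) (m i : ℕ) : 0 ≤ arWeight r m i := by
  unfold arWeight
  split_ifs
  · nlinarith
  · exact zero_le_one

lemma arCov_posSemidef {r : ℝ} (h0 : 0 < r) (h1 : r ≤ 1) (m : ℕ) (x : ℕ → ℝ) :
    0 ≤ ∑ i ∈ Finset.range (m + 1), ∑ j ∈ Finset.range (m + 1), x i * x j * arCov r i j := by
  set g : ℕ → ℝ := fun l => (r ^ (2 * (l + 1)))⁻¹ - (r ^ (2 * l))⁻¹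
  have hg (l : ℕ) : 0 ≤ g l :=
    sub_nonneg.2 (inv_anti₀ (by positivity) (pow_le_pow_of_le_one h0.le h1 (by omega)))
  have hD (i j : ℕ) (hi : i ∈ Finset.range (m + 1)) : arCov r i j
      = ∑ l ∈ Finset.range m, g l * ((if l < i then r ^ i else 0) * (if l < j then r ^ j else 0)) := by
    have hi' : i ≤ m := Nat.lt_succ_iff.1 (Finset.mem_range.1 hi)
    have e1 : ∑ l ∈ Finset.range m, g l * ((if l < i then r ^ i else 0) *
          (if l < j then r ^ j else 0))
        = ∑ l ∈ Finset.range (min i j), g l * (r ^ i * r ^ j) := by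
      rw [← Finset.sum_subset (Finset.range_mono ((min_le_left i j).trans hi'))]
      · refine Finset.sum_congr rfl fun l hl => ?_
        have := Finset.mem_range.1 hl
        rw [if_pos (by omega), if_pos (by omega)]
      · intro l _ hl
        have : ¬ (l < i ∧ l < j) := by
          rw [Finset.mem_range] at hl; omega
        rcases not_and_or.1 this with h | h <;> simp [h]
    rw [e1, ← Finset.sum_mul, Finset.sum_range_sub (fun l => (r ^ (2 * l))⁻¹)]
    unfold arCov
    have : r ^ (i - j + (j - i)) * r ^ (2 * min i j) = r ^ i * r ^ j := by
      rw [← pow_add, ← pow_add]; congr 1; omega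
    rw [← this, pow_add r i j, ← this]
    field_simp
    simp
  have : ∑ i ∈ Finset.range (m + 1), ∑ j ∈ Finset.range (m + 1), x i * x j * arCov r i j
      = ∑ l ∈ Finset.range m,
        g l * (∑ i ∈ Finset.range (m + 1), x i * (if l < i then r ^ i else 0)) ^ 2 := by
    calc _ = ∑ i ∈ Finset.range (m + 1), ∑ j ∈ Finset.range (m + 1), ∑ l ∈ Finset.range m,
          g l * ((x i * (if l < i then r ^ i else 0)) * (x j * (if l < j then r ^ j else 0))) := by
          refine Finset.sum_congr rfl fun i hi => Finset.sum_congr rfl fun j _ => ?_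
          rw [hD i j hi, Finset.mul_sum]
          exact Finset.sum_congr rfl fun l _ => by ring
      _ = _ := by
          simp_rw [sq, Finset.sum_mul_sum, Finset.mul_sum]
          refine (Finset.sum_congr rfl fun i _ => Finset.sum_comm).trans ?_
          exact Finset.sum_comm
  rw [this]
  exact Finset.sum_nonneg fun l _ => mul_nonneg (hg l) (sq_nonneg _)

lemma one_sub_mul_sum_pow_dist_le {r : ℝ} (h0 : 0 ≤ r) (h1 : r ≤ 1) (i m : ℕ) :
    (1 - r) * ∑ j ∈ Finset.range m, r ^ ((i - j) + (j - i)) ≤ 2 := by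
  have hA (n : ℕ) (hn : n ≤ i) :
      (1 - r) * ∑ j ∈ Finset.range n, r ^ ((i - j) + (j - i)) ≤ r ^ (i - n + 1) := by
    induction n with
    | zero => simpa using pow_nonneg h0 _
    | succ n ih =>
      rw [Finset.sum_range_succ, mul_add]
      have := ih (by omega)
      rw [show i - n + (n - i) = i - n by omega, show i - (n + 1) + 1 = i - n by omega]
      rw [pow_succ] at this
      linarith
  have hB (n : ℕ) :
      (1 - r) * ∑ j ∈ Finset.range (i + n), r ^ ((i - j) + (j - i)) ≤ 2 - r ^ n := by
    induction n with
    | zero =>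
      have := hA i le_rfl
      simp only [tsub_self, zero_add, pow_one] at this
      simp only [add_zero, pow_zero]
      linarith
    | succ n ih =>
      rw [← add_assoc, Finset.sum_range_succ, mul_add,
        show i - (i + n) + (i + n - i) = n by omega, pow_succ]
      linarith
  rcases le_total m i with h | h
  · exact (hA m h).trans ((pow_le_one₀ h0 h1).trans one_le_two)
  · obtain ⟨n, rfl⟩ := Nat.exists_eq_add_of_le h
    exact (hB n).trans (sub_le_self _ (pow_nonneg h0 _))

lemma sum_arWeight_mul_arCov_le {r : ℝ} (h0 : 0 ≤ r) (h1 : r ≤ 1) (i m : ℕ) :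
    ∑ j ∈ Finset.range (m + 1), arWeight r m j * arCov r i j ≤ 5 := by
  rw [sum_arWeight_mul]
  have hm : arCov r i m ≤ 1 := (arCov_le h0 i m).trans (pow_le_one₀ h0 h1)
  have hs : ∑ j ∈ Finset.range m, arCov r i j ≤ ∑ j ∈ Finset.range m, r ^ ((i - j) + (j - i)) :=
    Finset.sum_le_sum fun j _ => arCov_le h0 i j
  have h2 := one_sub_mul_sum_pow_dist_le h0 h1 i m
  have h3 : (1 - r ^ 2) * ∑ j ∈ Finset.range m, arCov r i j ≤ 4 := by
    calc _ ≤ (1 - r ^ 2) * ∑ j ∈ Finset.range m, r ^ ((i - j) + (j - i)) :=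
          mul_le_mul_of_nonneg_left hs (by nlinarith)
      _ = (1 + r) * ((1 - r) * ∑ j ∈ Finset.range m, r ^ ((i - j) + (j - i))) := by ring
      _ ≤ (1 + r) * 2 := mul_le_mul_of_nonneg_left h2 (by linarith)
      _ ≤ 4 := by linarith
  linarith

lemma sum_arWeight_mul_arCov_self (r : ℝ) (m : ℕ) :
    ∑ i ∈ Finset.range (m + 1), arWeight r m i * arCov r i i = m * (1 - r ^ 2) := by
  rw [sum_arWeight_mul]
  induction m with
  | zero => simp [arCov_self]
  | succ m ih =>
    rw [Finset.sum_range_succ]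
    have : arCov r (m + 1) (m + 1) = r ^ 2 * arCov r m m + (1 - r ^ 2) := by
      rw [arCov_self, arCov_self]; ring
    rw [this]
    push_cast
    linarith

lemma sum_sum_arWeight_mul_arCov_sq (r : ℝ) (m : ℕ) :
    ∑ i ∈ Finset.range (m + 1), ∑ j ∈ Finset.range (m + 1),
        arWeight r m i * arWeight r m j * arCov r i j ^ 2
      = arCov r m m ^ 2 + (1 - r ^ 4) * ∑ i ∈ Finset.range m, arCov r i i ^ 2 := by
  have e (m : ℕ) : ∑ i ∈ Finset.range (m + 1), ∑ j ∈ Finset.range (m + 1),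
        arWeight r m i * arWeight r m j * arCov r i j ^ 2
      = (1 - r ^ 2) ^ 2 * ∑ i ∈ Finset.range m, ∑ j ∈ Finset.range m, arCov r i j ^ 2
        + 2 * (1 - r ^ 2) * ∑ i ∈ Finset.range m, arCov r i m ^ 2 + arCov r m m ^ 2 := by
    simp_rw [mul_assoc, ← Finset.mul_sum]
    rw [sum_arWeight_mul]
    simp_rw [sum_arWeight_mul, arCov_comm r m]
    rw [Finset.sum_add_distrib, ← Finset.mul_sum]
    ring
  rw [e]
  induction m with
  | zero => simp
  | succ m ih =>
    have s1 : ∑ i ∈ Finset.range (m + 1), arCov r i (m + 1) ^ 2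
        = r ^ 2 * ∑ i ∈ Finset.range (m + 1), arCov r i m ^ 2 := by
      rw [Finset.mul_sum]
      refine Finset.sum_congr rfl fun i hi => ?_
      rw [arCov_succ r (Nat.lt_succ_iff.1 (Finset.mem_range.1 hi)), mul_pow]
    have s2 : ∑ i ∈ Finset.range (m + 1), ∑ j ∈ Finset.range (m + 1), arCov r i j ^ 2
        = ∑ i ∈ Finset.range m, ∑ j ∈ Finset.range m, arCov r i j ^ 2
          + 2 * ∑ i ∈ Finset.range m, arCov r i m ^ 2 + arCov r m m ^ 2 := by
      simp_rw [Finset.sum_range_succ, Finset.sum_add_distrib, arCov_comm r m]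
      ring
    rw [s1, s2, Finset.sum_range_succ (fun i => arCov r i m ^ 2),
      Finset.sum_range_succ (fun i => arCov r i i ^ 2)]
    linear_combination ih

lemma abs_sum_sum_arWeight_mul_arCov_sq_sub_le {r : ℝ} (h0 : 0 ≤ r) (h1 : r < 1) (m : ℕ) :
    |∑ i ∈ Finset.range (m + 1), ∑ j ∈ Finset.range (m + 1),
        arWeight r m i * arWeight r m j * arCov r i j ^ 2 - m * (1 - r ^ 4)| ≤ 4 := by
  rw [sum_sum_arWeight_mul_arCov_sq]
  have hd0 (i : ℕ) : 0 ≤ arCov r i i := arCov_nonneg h0 h1.le i i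
  have hd1 (i : ℕ) : arCov r i i ≤ 1 := by
    rw [arCov_self]; linarith [pow_nonneg h0 (2 * i)]
  have hr2 : r ^ 2 < 1 := by nlinarith
  have hr4 : 0 ≤ 1 - r ^ 4 := by nlinarith [sq_nonneg r]
  have hup : ∑ i ∈ Finset.range m, arCov r i i ^ 2 ≤ m := by
    calc _ ≤ ∑ i ∈ Finset.range m, (1 : ℝ) :=
          Finset.sum_le_sum fun i _ => pow_le_one₀ (hd0 i) (hd1 i)
      _ = m := by simp
  have hlow : (m : ℝ) - 2 * ∑ i ∈ Finset.range m, (r ^ 2) ^ i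
      ≤ ∑ i ∈ Finset.range m, arCov r i i ^ 2 := by
    calc _ = ∑ i ∈ Finset.range m, ((1 : ℝ) - 2 * (r ^ 2) ^ i) := by
          rw [Finset.sum_sub_distrib, Finset.mul_sum]; simp
      _ ≤ _ := Finset.sum_le_sum fun i _ => by
          rw [arCov_self, pow_mul]; nlinarith [sq_nonneg ((r ^ 2) ^ i)]
  have hgeom : (1 - r ^ 2) * ∑ i ∈ Finset.range m, (r ^ 2) ^ i ≤ 1 := by
    rw [mul_neg_geom_sum]
    linarith [pow_nonneg (sq_nonneg r) m]
  have hg2 : (1 - r ^ 4) * ∑ i ∈ Finset.range m, (r ^ 2) ^ i ≤ 2 := by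
    calc _ = (1 + r ^ 2) * ((1 - r ^ 2) * ∑ i ∈ Finset.range m, (r ^ 2) ^ i) := by ring
      _ ≤ (1 + r ^ 2) * 1 := mul_le_mul_of_nonneg_left hgeom (by positivity)
      _ ≤ 2 := by linarith
  have hm2 : arCov r m m ^ 2 ≤ 1 := pow_le_one₀ (hd0 m) (hd1 m)
  have := mul_le_mul_of_nonneg_left hup hr4
  have := mul_le_mul_of_nonneg_left hlow hr4
  rw [abs_le]
  constructor <;> nlinarith [sq_nonneg (arCov r m m)]

lemma sum_coe_prod_fin (K : Finset ℕ) (m : ℕ) (f : ℕ → ℕ → ℝ) :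
    ∑ p : K × Fin m, f p.1 p.2 = ∑ k ∈ K, ∑ i ∈ Finset.range m, f k i := by
  rw [Fintype.sum_prod_type, ← Finset.sum_coe_sort K]
  exact Finset.sum_congr rfl fun k _ => Fin.sum_univ_eq_sum_range (fun i => f k i) m

lemma sum_sum_coe_prod_fin_ite (K : Finset ℕ) (m : ℕ) (f : ℕ → ℕ → ℕ → ℝ) :
    ∑ p : K × Fin m, ∑ p' : K × Fin m, (if (p.1 : ℕ) = p'.1 then f p.1 p.2 p'.2 else 0)
      = ∑ k ∈ K, ∑ i ∈ Finset.range m, ∑ j ∈ Finset.range m, f k i j := by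
  have h (p : K × Fin m) :
      ∑ p' : K × Fin m, (if (p.1 : ℕ) = p'.1 then f p.1 p.2 p'.2 else 0)
        = ∑ j ∈ Finset.range m, f p.1 p.2 j := by
    rw [sum_coe_prod_fin K m (fun k' j => if (p.1 : ℕ) = k' then f p.1 p.2 j else 0),
      Finset.sum_eq_single_of_mem (p.1 : ℕ) p.1.2]
    · simp
    · intro k _ hk
      simp [hk.symm]
  simp_rw [h]
  exact sum_coe_prod_fin K m (fun k i => ∑ j ∈ Finset.range m, f k i j)

lemma norm_integral_exp_sum_arWeight_sub_le {Ω : Type*} [MeasurableSpace Ω] {P : Measure Ω}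
    [IsProbabilityMeasure P] (K : Finset ℕ) (m : ℕ) (Z : ℕ → ℕ → Ω → ℝ) (a κ r : ℕ → ℝ)
    (ha : ∀ k, 0 ≤ a k) (hκ : ∀ k, 0 ≤ κ k) (hr0 : ∀ k, 0 < r k) (hr1 : ∀ k, r k ≤ 1) {Λ : ℝ}
    (hΛ : ∀ k ∈ K, a k * κ k * 5 ≤ Λ)
    (hZ : ∀ b : K × Fin (m + 1) → ℝ, P.map (fun ω => ∑ p, b p * Z p.1 p.2 ω)
      = gaussianReal 0 (∑ p, ∑ p', b p * b p' *
        (if (p.1 : ℕ) = p'.1 then κ p.1 * arCov (r p.1) p.2 p'.2 else 0)).toNNReal) (s : ℝ) :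
    ‖∫ ω, Complex.exp (((s * ∑ k ∈ K, a k * ((1 - r k ^ 2) * ∑ i ∈ Finset.range m, Z k i ω ^ 2
          + Z k m ω ^ 2 - κ k * (m * (1 - r k ^ 2))) : ℝ) : ℂ) * Complex.I) ∂P
      - (rexp (-(s ^ 2 * ∑ k ∈ K, (a k * κ k) ^ 2 * ∑ i ∈ Finset.range (m + 1),
          ∑ j ∈ Finset.range (m + 1),
            arWeight (r k) m i * arWeight (r k) m j * arCov (r k) i j ^ 2)) : ℂ)‖
      ≤ gaussSqConst * |s| ^ 3 * Λ * ∑ k ∈ K, (a k * κ k) ^ 2 * ∑ i ∈ Finset.range (m + 1),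
          ∑ j ∈ Finset.range (m + 1),
            arWeight (r k) m i * arWeight (r k) m j * arCov (r k) i j ^ 2 := by
  have hw0 (k i : ℕ) : 0 ≤ arWeight (r k) m i := arWeight_nonneg (hr0 k).le (hr1 k) m i
  have key := norm_integral_exp_centered_weighted_sub_le (P := P) (Λ := Λ)
    (fun (p : K × Fin (m + 1)) ω => Z p.1 p.2 ω)
    (fun p p' => if (p.1 : ℕ) = p'.1 then κ p.1 * arCov (r p.1) p.2 p'.2 else 0)
    (fun p => a p.1 * arWeight (r p.1) m p.2)
    (fun p => mul_nonneg (ha _) (hw0 _ _)) ?_ ?_ ?_ hZ s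
  · have e1 : ∑ p : K × Fin (m + 1), a p.1 * arWeight (r p.1) m p.2 *
          (κ p.1 * arCov (r p.1) p.2 p.2)
        = ∑ k ∈ K, a k * (κ k * (m * (1 - r k ^ 2))) := by
      rw [sum_coe_prod_fin K (m + 1) (fun k i => a k * arWeight (r k) m i *
        (κ k * arCov (r k) i i))]
      refine Finset.sum_congr rfl fun k _ => ?_
      rw [← sum_arWeight_mul_arCov_self, Finset.mul_sum, Finset.mul_sum]
      exact Finset.sum_congr rfl fun i _ => by ring
    have e2 (ω : Ω) : ∑ p : K × Fin (m + 1), a p.1 * arWeight (r p.1) m p.2 * Z p.1 p.2 ω ^ 2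
        = ∑ k ∈ K, a k * ((1 - r k ^ 2) * ∑ i ∈ Finset.range m, Z k i ω ^ 2 + Z k m ω ^ 2) := by
      rw [sum_coe_prod_fin K (m + 1) (fun k i => a k * arWeight (r k) m i * Z k i ω ^ 2)]
      refine Finset.sum_congr rfl fun k _ => ?_
      rw [← sum_arWeight_mul (r k) m (fun i => Z k i ω ^ 2), Finset.mul_sum]
      exact Finset.sum_congr rfl fun i _ => by ring
    have e3 : ∑ p : K × Fin (m + 1), ∑ p' : K × Fin (m + 1),
          a p.1 * arWeight (r p.1) m p.2 * (a p'.1 * arWeight (r p'.1) m p'.2) *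
          (if (p.1 : ℕ) = p'.1 then κ p.1 * arCov (r p.1) p.2 p'.2 else 0) ^ 2
        = ∑ k ∈ K, (a k * κ k) ^ 2 * ∑ i ∈ Finset.range (m + 1), ∑ j ∈ Finset.range (m + 1),
            arWeight (r k) m i * arWeight (r k) m j * arCov (r k) i j ^ 2 := by
      simp_rw [Finset.mul_sum]
      rw [← sum_sum_coe_prod_fin_ite K (m + 1) (fun k i j => (a k * κ k) ^ 2 *
        (arWeight (r k) m i * arWeight (r k) m j * arCov (r k) i j ^ 2))]
      refine Finset.sum_congr rfl fun p _ => Finset.sum_congr rfl fun p' _ => ?_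
      split_ifs with h
      · rw [h]; ring
      · ring
    simp only [if_true, e1, e2, e3] at key
    simp only [mul_sub (a _), Finset.sum_sub_distrib]
    exact key
  · intro p p'
    by_cases h : (p.1 : ℕ) = p'.1
    · simp [h, arCov_comm]
    · simp [h, Ne.symm h]
  · intro x
    have e := sum_sum_coe_prod_fin_ite K (m + 1) (fun k i j =>
      (if h : k ∈ K ∧ i < m + 1 then x (⟨k, h.1⟩, ⟨i, h.2⟩) else 0) *
      (if h : k ∈ K ∧ j < m + 1 then x (⟨k, h.1⟩, ⟨j, h.2⟩) else 0) * (κ k * arCov (r k) i j))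
    refine le_trans (Finset.sum_nonneg fun k _ => ?_) (e.symm.trans ?_).le
    · have := mul_nonneg (hκ k) (arCov_posSemidef (hr0 k) (hr1 k) m
        (fun i => if h : k ∈ K ∧ i < m + 1 then x (⟨k, h.1⟩, ⟨i, h.2⟩) else 0))
      refine this.trans_eq ?_
      simp_rw [Finset.mul_sum]
      exact Finset.sum_congr rfl fun i _ => Finset.sum_congr rfl fun j _ => by ring
    · refine Finset.sum_congr rfl fun p _ => Finset.sum_congr rfl fun p' _ => ?_
      rcases p with ⟨⟨k, hk⟩, i⟩
      rcases p' with ⟨⟨k', hk'⟩, j⟩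
      by_cases h : k = k'
      · subst h
        simp [hk, i.2, j.2]
      · simp [h]
  · intro p
    have : ∑ p' : K × Fin (m + 1), a p'.1 * arWeight (r p'.1) m p'.2 *
          |if (p.1 : ℕ) = p'.1 then κ p.1 * arCov (r p.1) p.2 p'.2 else 0|
        = a p.1 * κ p.1 * ∑ j ∈ Finset.range (m + 1),
          arWeight (r p.1) m j * arCov (r p.1) p.2 j := by
      rw [sum_coe_prod_fin K (m + 1) (fun k' j => a k' * arWeight (r k') m j *
          |if (p.1 : ℕ) = k' then κ p.1 * arCov (r p.1) p.2 j else 0|),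
        Finset.sum_eq_single_of_mem (p.1 : ℕ) p.1.2, Finset.mul_sum]
      · refine Finset.sum_congr rfl fun j _ => ?_
        rw [if_pos rfl, abs_of_nonneg (mul_nonneg (hκ _) (arCov_nonneg (hr0 _).le (hr1 _) _ _))]
        ring
      · intro k _ hk
        simp [hk.symm]
    rw [this]
    exact (mul_le_mul_of_nonneg_left (sum_arWeight_mul_arCov_le (hr0 _).le (hr1 _) _ _)
      (mul_nonneg (ha _) (hκ _))).trans (hΛ _ p.1.2)

lemma IsIndepOUFamily.map_sum_eq {Ω ι : Type*} [MeasurableSpace Ω] [Fintype ι] {P : Measure Ω}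
    {u : ℕ → ℝ → Ω → ℝ} {θ σ : ℝ} {ν q : ℕ → ℝ} {T : ℝ} (h : IsIndepOUFamily P u θ σ ν q T)
    (k : ι → ℕ) (t : ι → ℝ) (ht : ∀ i, t i ∈ Set.Icc (0 : ℝ) T) (a : ι → ℝ) :
    P.map (fun ω => ∑ i, a i * u (k i) (t i) ω)
      = gaussianReal 0 (∑ i, ∑ j, a i * a j *
        (if k i = k j then ouCov θ σ (ν (k i)) (q (k i)) (t i) (t j) else 0)).toNNReal := by
  have e := (Fintype.equivFin ι).symm
  have := h (Fintype.card ι) (k ∘ e) (t ∘ e) (fun i => ht _) (a ∘ e)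
  simp only [Function.comp_apply] at this
  refine Eq.trans ?_ (this.trans ?_)
  · congr 1
    exact funext fun ω => (e.sum_comp (fun i => a i * u (k i) (t i) ω)).symm
  · congr 2
    rw [← e.sum_comp]
    exact Finset.sum_congr rfl fun i _ => e.sum_comp (fun j => a (e i) * a j *
        (if k (e i) = k j then ouCov θ σ (ν (k (e i))) (q (k (e i))) (t (e i)) (t j) else 0))

lemma ouCov_grid (θ σ ν q h : ℝ) (hh : 0 ≤ h) (i j : ℕ) :
    ouCov θ σ ν q (i * h) (j * h)
      = σ ^ 2 * q ^ 2 / (2 * θ * ν) * arCov (rexp (-(θ * ν * h))) i j := by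
  unfold ouCov arCov
  rw [← Real.exp_nat_mul, ← Real.exp_nat_mul]
  have : |(j : ℝ) * h - i * h| = ((i - j + (j - i) : ℕ) : ℝ) * h := by
    rw [← sub_mul, abs_mul, abs_of_nonneg hh]
    congr 1
    rcases le_total i j with hij | hij
    · rw [abs_of_nonneg (sub_nonneg.2 (by exact_mod_cast hij)), Nat.sub_eq_zero_of_le hij, zero_add,
        Nat.cast_sub hij]
    · rw [abs_of_nonpos (sub_nonpos.2 (by exact_mod_cast hij)), Nat.sub_eq_zero_of_le hij, add_zero,
        Nat.cast_sub hij, neg_sub]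
  rw [this]
  congr 3
  · ring
  · push_cast; ring

lemma tendsto_riemann_sum {f : ℝ → ℝ} {T : ℝ} (hT : 0 < T) (hf : ContinuousOn f (Set.Icc 0 T)) :
    Tendsto (fun m : ℕ => T / m * ∑ i ∈ Finset.range m, f (i * (T / m))) atTop
      (nhds (∫ t in (0 : ℝ)..T, f t)) := by
  rw [Metric.tendsto_atTop]
  intro ε hε
  have huc := isCompact_Icc.uniformContinuousOn_of_continuous hf
  rw [Metric.uniformContinuousOn_iff] at huc
  obtain ⟨δ, hδ, H⟩ := huc (ε / (2 * T)) (by positivity)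
  obtain ⟨m₀, hm₀⟩ := exists_nat_gt (T / δ)
  refine ⟨m₀ + 1, fun m hm => ?_⟩
  have hm1 : m₀ + 1 ≤ m := hm
  have hmpos : (0 : ℝ) < m := by exact_mod_cast (by omega : 0 < m)
  set h := T / m with hh
  have hpos : 0 < h := by positivity
  have hhδ : h < δ := by
    rw [hh, div_lt_iff₀ hmpos, mul_comm, ← div_lt_iff₀ hδ]
    refine hm₀.trans ?_
    exact_mod_cast (by omega : m₀ < m)
  have hmh : (m : ℝ) * h = T := by rw [hh]; field_simp
  have hsub (i : ℕ) (hi : i < m) : Set.Icc (i * h) ((i + 1 : ℕ) * h) ⊆ Set.Icc 0 T := by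
    refine Set.Icc_subset_Icc (by positivity) ?_
    rw [← hmh]
    exact mul_le_mul_of_nonneg_right (by exact_mod_cast hi) hpos.le
  have hle (i : ℕ) : (i : ℝ) * h ≤ (i + 1 : ℕ) * h := by
    push_cast; nlinarith
  have hint (i : ℕ) (hi : i < m) : IntervalIntegrable f volume (i * h) ((i + 1 : ℕ) * h) := by
    refine (hf.mono ?_).intervalIntegrable
    rw [Set.uIcc_of_le (hle i)]
    exact hsub i hi
  have hsum : ∫ t in (0 : ℝ)..T, f t
      = ∑ i ∈ Finset.range m, ∫ t in (i * h)..((i + 1 : ℕ) * h), f t := by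
    rw [intervalIntegral.sum_integral_adjacent_intervals (a := fun i : ℕ => (i : ℝ) * h)
      (fun i hi => hint i hi)]
    simp [hmh]
  rw [hsum, Finset.mul_sum, Real.dist_eq, ← Finset.sum_sub_distrib]
  have hterm (i : ℕ) (hi : i ∈ Finset.range m) :
      |h * f (i * h) - ∫ t in (i * h)..((i + 1 : ℕ) * h), f t| ≤ ε / (2 * T) * h := by
    have hi := Finset.mem_range.1 hi
    have e : h * f (i * h) = ∫ t in (i * h)..((i + 1 : ℕ) * h), f (i * h) := by
      rw [intervalIntegral.integral_const, smul_eq_mul]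
      push_cast; ring
    rw [e, ← intervalIntegral.integral_sub (by simp) (hint i hi)]
    have := intervalIntegral.norm_integral_le_of_norm_le_const (a := i * h)
      (b := (i + 1 : ℕ) * h) (C := ε / (2 * T)) (f := fun t => f (i * h) - f t) ?_
    · refine this.trans_eq ?_
      rw [abs_of_nonneg (sub_nonneg.2 (hle i))]
      push_cast; ring
    · intro t ht
      rw [Set.uIoc_of_le (hle i)] at ht
      rw [← dist_eq_norm]
      refine (H _ (hsub i hi ⟨le_rfl, hle i⟩) _ (hsub i hi ⟨ht.1.le, ht.2⟩) ?_).le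
      rw [Real.dist_eq, abs_sub_comm, abs_of_nonneg (by linarith [ht.1])]
      have := ht.2
      push_cast at this
      linarith
  calc _ ≤ ∑ i ∈ Finset.range m, ε / (2 * T) * h :=
        (Finset.abs_sum_le_sum_abs _ _).trans (Finset.sum_le_sum hterm)
    _ = ε / (2 * T) * (m * h) := by
        rw [Finset.sum_const, Finset.card_range, nsmul_eq_mul]; ring
    _ = ε / 2 := by rw [hmh]; field_simp
    _ < ε := by linarith

lemma tendsto_mul_one_sub_exp_neg_div (x : ℝ) :
    Tendsto (fun m : ℕ => (m : ℝ) * (1 - rexp (-(x / m)))) atTop (nhds x) := by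
  have hd : HasDerivAt (fun t : ℝ => 1 - rexp (-(x * t))) x 0 := by
    have := (((hasDerivAt_id (0 : ℝ)).const_mul x).neg.exp).const_sub 1
    simpa using this
  have := hd.tendsto_slope_zero
  have h2 : Tendsto (fun m : ℕ => ((m : ℝ))⁻¹) atTop (nhdsWithin 0 {0}ᶜ) := by
    refine tendsto_nhdsWithin_iff.2 ⟨tendsto_inv_atTop_nhds_zero_nat, ?_⟩
    filter_upwards [eventually_gt_atTop 0] with m hm
    simp [hm.ne']
  refine (this.comp h2).congr fun m => ?_
  simp [div_eq_mul_inv]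

lemma tendsto_ar_sum {f : ℝ → ℝ} {T : ℝ} (hT : 0 < T) (c : ℝ)
    (hf : ContinuousOn f (Set.Icc 0 T)) :
    Tendsto (fun m : ℕ => (1 - rexp (-(c * (T / m))) ^ 2) *
      ∑ i ∈ Finset.range m, f (i * (T / m)) ^ 2 + f (m * (T / m)) ^ 2
        - m * (1 - rexp (-(c * (T / m))) ^ 2)) atTop
      (nhds (2 * c * (∫ t in (0 : ℝ)..T, f t ^ 2) + f T ^ 2 - 2 * c * T)) := by
  have h1 := tendsto_mul_one_sub_exp_neg_div (2 * c * T)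
  have h2 := tendsto_riemann_sum hT (hf.pow 2)
  have h3 := ((((h1.div_const T).mul h2).add_const (f T ^ 2)).sub h1)
  have e : 2 * c * T / T * (∫ t in (0 : ℝ)..T, f t ^ 2) + f T ^ 2 - 2 * c * T
      = 2 * c * (∫ t in (0 : ℝ)..T, f t ^ 2) + f T ^ 2 - 2 * c * T := by
    field_simp
  simp only [Pi.pow_apply] at h3
  rw [e] at h3
  refine h3.congr' ?_
  filter_upwards [eventually_gt_atTop 0] with m hm
  have hm' : (m : ℝ) ≠ 0 := by exact_mod_cast hm.ne'
  have e1 : rexp (-(c * (T / m))) ^ 2 = rexp (-(2 * c * T / m)) := by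
    rw [← Real.exp_nat_mul]; congr 1; push_cast; ring
  have e2 : (m : ℝ) * (T / m) = T := by field_simp
  rw [e1, e2]
  field_simp

lemma IsIndepOUFamily.map_eq {Ω : Type*} [MeasurableSpace Ω] {P : Measure Ω}
    {u : ℕ → ℝ → Ω → ℝ} {θ σ : ℝ} {ν q : ℕ → ℝ} {T : ℝ} (h : IsIndepOUFamily P u θ σ ν q T)
    (k : ℕ) {t : ℝ} (ht : t ∈ Set.Icc (0 : ℝ) T) :
    P.map (u k t) = gaussianReal 0 (ouCov θ σ (ν k) (q k) t t).toNNReal := by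
  simpa using h.map_sum_eq (ι := Unit) (fun _ => k) (fun _ => t) (fun _ => ht) (fun _ => 1)

lemma IsIndepOUFamily.aemeasurable {Ω : Type*} [MeasurableSpace Ω] {P : Measure Ω}
    {u : ℕ → ℝ → Ω → ℝ} {θ σ : ℝ} {ν q : ℕ → ℝ} {T : ℝ} (h : IsIndepOUFamily P u θ σ ν q T)
    (k : ℕ) {t : ℝ} (ht : t ∈ Set.Icc (0 : ℝ) T) : AEMeasurable (u k t) P :=
  AEMeasurable.of_map_ne_zero (by rw [h.map_eq k ht]; exact IsProbabilityMeasure.ne_zero _)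

lemma mul_div_mem_Icc {T : ℝ} (hT : 0 < T) {i m : ℕ} (hi : i ≤ m) :
    (i : ℝ) * (T / m) ∈ Set.Icc 0 T := by
  refine ⟨by positivity, ?_⟩
  rcases Nat.eq_zero_or_pos m with rfl | hm
  · simp [hT.le]
  · have : (0 : ℝ) < m := by exact_mod_cast hm
    rw [← mul_div_assoc, div_le_iff₀ this, mul_comm]
    exact mul_le_mul_of_nonneg_left (by exact_mod_cast hi) hT.le

lemma IsIndepOUFamily.aemeasurable_integral_sq {Ω : Type*} [MeasurableSpace Ω] {P : Measure Ω}
    {u : ℕ → ℝ → Ω → ℝ} {θ σ : ℝ} {ν q : ℕ → ℝ} {T : ℝ} (h : IsIndepOUFamily P u θ σ ν q T)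
    (hT : 0 < T) (hcont : ∀ k ω, ContinuousOn (fun t => u k t ω) (Set.Icc 0 T)) (k : ℕ) :
    AEMeasurable (fun ω => ∫ t in (0 : ℝ)..T, u k t ω ^ 2) P := by
  refine aemeasurable_of_tendsto_metrizable_ae atTop
    (f := fun m ω => T / m * ∑ i ∈ Finset.range m, u k (i * (T / m)) ω ^ 2) (fun m => ?_)
    (ae_of_all _ fun ω => tendsto_riemann_sum hT ((hcont k ω).pow 2))
  refine AEMeasurable.const_mul (Finset.aemeasurable_fun_sum _ fun i hi => ?_) _
  exact (h.aemeasurable k (mul_div_mem_Icc hT (Finset.mem_range.1 hi).le)).pow_const 2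

lemma IsIndepOUFamily.integrable_sq {Ω : Type*} [MeasurableSpace Ω] {P : Measure Ω}
    {u : ℕ → ℝ → Ω → ℝ} {θ σ : ℝ} {ν q : ℕ → ℝ} {T : ℝ} (h : IsIndepOUFamily P u θ σ ν q T)
    (k : ℕ) {t : ℝ} (ht : t ∈ Set.Icc (0 : ℝ) T) : Integrable (fun ω => u k t ω ^ 2) P := by
  have := integrable_pow_gaussianReal 2 (ouCov θ σ (ν k) (q k) t t).toNNReal
  rw [← h.map_eq k ht] at this
  exact this.comp_aemeasurable (h.aemeasurable k ht)

lemma IsIndepOUFamily.integral_sq_le {Ω : Type*} [MeasurableSpace Ω] {P : Measure Ω}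
    {u : ℕ → ℝ → Ω → ℝ} {θ σ : ℝ} {ν q : ℕ → ℝ} {T : ℝ} (h : IsIndepOUFamily P u θ σ ν q T)
    (hθ : 0 < θ) (hν : ∀ k, 0 < ν k) (k : ℕ) {t : ℝ} (ht : t ∈ Set.Icc (0 : ℝ) T) :
    ∫ ω, u k t ω ^ 2 ∂P ≤ σ ^ 2 * q k ^ 2 / (2 * θ * ν k) := by
  have hκ : 0 ≤ σ ^ 2 * q k ^ 2 / (2 * θ * ν k) := by have := hν k; positivity
  have e : ∫ ω, u k t ω ^ 2 ∂P = (ouCov θ σ (ν k) (q k) t t).toNNReal := by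
    rw [← integral_sq_gaussianReal, ← h.map_eq k ht,
      integral_map (h.aemeasurable k ht) (by fun_prop)]
  rw [e, Real.coe_toNNReal']
  refine max_le ?_ hκ
  unfold ouCov
  refine mul_le_of_le_one_right hκ ?_
  simp [Real.exp_nonneg]

/-- Gaussian approximation, with an explicit error, of the characteristic function of a weighted
sum of the centered quadratic functionals `u_k(T) ^ 2 + 2 θ ν_k ∫ u_k ^ 2 - σ² q_k² T`. -/
lemma IsIndepOUFamily.norm_integral_exp_sub_le {Ω : Type*} [MeasurableSpace Ω] {P : Measure Ω}
    [IsProbabilityMeasure P]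
    {u : ℕ → ℝ → Ω → ℝ} {θ σ : ℝ} {ν q : ℕ → ℝ} {T : ℝ} (h : IsIndepOUFamily P u θ σ ν q T)
    (hθ : 0 < θ) (hT : 0 < T) (hν : ∀ k, 0 < ν k)
    (hcont : ∀ k ω, ContinuousOn (fun t => u k t ω) (Set.Icc 0 T))
    (K : Finset ℕ) (a : ℕ → ℝ) (ha : ∀ k, 0 ≤ a k) {κ : ℕ → ℝ}
    (hκ : ∀ k, κ k = σ ^ 2 * q k ^ 2 / (2 * θ * ν k)) {Λ : ℝ} (hΛ0 : 0 ≤ Λ)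
    (hΛ : ∀ k ∈ K, a k * κ k * 5 ≤ Λ) (s : ℝ) :
    ‖∫ ω, Complex.exp (((s * ∑ k ∈ K, a k * (2 * (θ * ν k) * (∫ t in (0 : ℝ)..T, u k t ω ^ 2)
          + u k T ω ^ 2 - σ ^ 2 * q k ^ 2 * T) : ℝ) : ℂ) * Complex.I) ∂P
      - (rexp (-(s ^ 2 * ∑ k ∈ K, (a k * κ k) ^ 2 * (4 * (θ * ν k) * T))) : ℂ)‖
      ≤ gaussSqConst * |s| ^ 3 * Λ *
          (∑ k ∈ K, (a k * κ k) ^ 2 * (4 * (θ * ν k) * T) + ∑ k ∈ K, (a k * κ k) ^ 2 * 4)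
        + s ^ 2 * ∑ k ∈ K, (a k * κ k) ^ 2 * 4 := by
  have hκ0 (k : ℕ) : 0 ≤ κ k := by rw [hκ]; have := hν k; positivity
  set r : ℕ → ℕ → ℝ := fun m k => rexp (-(θ * ν k * (T / m))) with hr
  have hr0 (m k : ℕ) : 0 < r m k := Real.exp_pos _
  have hcT (m k : ℕ) : 0 ≤ θ * ν k * (T / m) := by have := hν k; positivity
  have hr1 (m k : ℕ) : r m k ≤ 1 := Real.exp_le_one_iff.2 (neg_nonpos.2 (hcT m k))
  set W : ℕ → ℝ := fun m => ∑ k ∈ K, (a k * κ k) ^ 2 * ∑ i ∈ Finset.range (m + 1),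
    ∑ j ∈ Finset.range (m + 1),
      arWeight (r m k) m i * arWeight (r m k) m j * arCov (r m k) i j ^ 2 with hW
  set V : ℕ → ℝ := fun m => ∑ k ∈ K, (a k * κ k) ^ 2 * (m * (1 - r m k ^ 4)) with hV
  set D := ∑ k ∈ K, (a k * κ k) ^ 2 * 4 with hD
  set V' := ∑ k ∈ K, (a k * κ k) ^ 2 * (4 * (θ * ν k) * T) with hV'
  set F : ℕ → Ω → ℝ := fun m ω => ∑ k ∈ K, a k * ((1 - r m k ^ 2) *
    ∑ i ∈ Finset.range m, u k (i * (T / m)) ω ^ 2 + u k (m * (T / m)) ω ^ 2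
      - κ k * (m * (1 - r m k ^ 2))) with hF
  have hr4 (m k : ℕ) : r m k ^ 4 = rexp (-(4 * (θ * ν k) * T / m)) := by
    rw [hr, ← Real.exp_nat_mul]; congr 1; push_cast; ring
  have hVlim : Tendsto V atTop (nhds V') := by
    refine tendsto_finsetSum _ fun k _ => Tendsto.const_mul _ ?_
    simp_rw [hr4]
    exact tendsto_mul_one_sub_exp_neg_div _
  have hVle (m : ℕ) (hm : 0 < m) : V m ≤ V' := by
    refine Finset.sum_le_sum fun k _ => mul_le_mul_of_nonneg_left ?_ (sq_nonneg _)
    have hm' : (0 : ℝ) < m := by exact_mod_cast hm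
    rw [hr4]
    have := Real.add_one_le_exp (-(4 * (θ * ν k) * T / m))
    calc (m : ℝ) * (1 - rexp (-(4 * (θ * ν k) * T / m)))
        ≤ m * (4 * (θ * ν k) * T / m) := mul_le_mul_of_nonneg_left (by linarith) hm'.le
      _ = _ := by field_simp
  have hWV (m : ℕ) (hm : 0 < m) : |W m - V m| ≤ D := by
    rw [hW, hV, ← Finset.sum_sub_distrib]
    refine (Finset.abs_sum_le_sum_abs _ _).trans (Finset.sum_le_sum fun k _ => ?_)
    rw [← mul_sub, abs_mul, abs_of_nonneg (sq_nonneg _)]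
    have hlt : r m k < 1 := by
      refine (Real.exp_lt_exp.2 ?_).trans_eq Real.exp_zero
      have hm' : (0 : ℝ) < m := by exact_mod_cast hm
      have := hν k
      have : 0 < θ * ν k * (T / m) := by positivity
      linarith
    exact mul_le_mul_of_nonneg_left
      (abs_sum_sum_arWeight_mul_arCov_sq_sub_le (hr0 m k).le hlt m) (sq_nonneg _)
  have hgrid (m : ℕ) := norm_integral_exp_sum_arWeight_sub_le (P := P) K m
    (fun k i ω => u k (i * (T / m)) ω) a κ (r m) ha hκ0 (hr0 m) (hr1 m) hΛ (by
      intro b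
      have := h.map_sum_eq (fun p : K × Fin (m + 1) => (p.1 : ℕ))
        (fun p => ((p.2 : ℕ) : ℝ) * (T / m))
        (fun p => mul_div_mem_Icc hT (Nat.lt_succ_iff.1 p.2.2)) b
      rw [this]
      simp_rw [ouCov_grid θ σ _ _ (T / m) (by positivity), hκ, hr]) s
  have hbound (m : ℕ) (hm : 0 < m) :
      ‖∫ ω, Complex.exp (((s * F m ω : ℝ) : ℂ) * Complex.I) ∂P
        - (rexp (-(s ^ 2 * V m)) : ℂ)‖ ≤ gaussSqConst * |s| ^ 3 * Λ * (V' + D) + s ^ 2 * D := by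
    have hWle : W m ≤ V' + D := by linarith [(abs_le.1 (hWV m hm)).2, hVle m hm]
    have hW0 : 0 ≤ W m := Finset.sum_nonneg fun k _ => mul_nonneg (sq_nonneg _)
      (Finset.sum_nonneg fun i _ => Finset.sum_nonneg fun j _ => mul_nonneg
        (mul_nonneg (arWeight_nonneg (hr0 m k).le (hr1 m k) _ _)
          (arWeight_nonneg (hr0 m k).le (hr1 m k) _ _)) (sq_nonneg _))
    have hV0 : 0 ≤ V m := Finset.sum_nonneg fun k _ => mul_nonneg (sq_nonneg _)
      (mul_nonneg (Nat.cast_nonneg _) (sub_nonneg.2 (pow_le_one₀ (hr0 m k).le (hr1 m k))))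
    have hexp : ‖(rexp (-(s ^ 2 * W m)) : ℂ) - (rexp (-(s ^ 2 * V m)) : ℂ)‖ ≤ s ^ 2 * D := by
      rw [← Complex.ofReal_sub, Complex.norm_real, Real.norm_eq_abs]
      have hLip (x y : ℝ) (hx : 0 ≤ x) (hxy : x ≤ y) : |rexp (-x) - rexp (-y)| ≤ y - x := by
        have h1 : rexp (-y) = rexp (-x) * rexp (-(y - x)) := by rw [← Real.exp_add]; ring_nf
        have h2 := Real.add_one_le_exp (-(y - x))
        have h3 : rexp (-x) ≤ 1 := Real.exp_le_one_iff.2 (by linarith)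
        have h4 : rexp (-(y - x)) ≤ 1 := Real.exp_le_one_iff.2 (by linarith)
        have h5 := Real.exp_pos (-x)
        rw [abs_of_nonneg (by rw [h1]; nlinarith), h1]
        nlinarith
      have hmain : |rexp (-(s ^ 2 * W m)) - rexp (-(s ^ 2 * V m))| ≤ s ^ 2 * |W m - V m| := by
        rcases le_total (W m) (V m) with hle | hle
        · refine (hLip _ _ (by positivity)
            (mul_le_mul_of_nonneg_left hle (sq_nonneg s))).trans_eq ?_
          rw [abs_of_nonpos (sub_nonpos.2 hle)]; ring
        · rw [abs_sub_comm]
          refine (hLip _ _ (by positivity)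
            (mul_le_mul_of_nonneg_left hle (sq_nonneg s))).trans_eq ?_
          rw [abs_of_nonneg (sub_nonneg.2 hle)]; ring
      exact hmain.trans (mul_le_mul_of_nonneg_left (hWV m hm) (sq_nonneg _))
    refine (norm_sub_le_norm_sub_add_norm_sub _ (rexp (-(s ^ 2 * W m)) : ℂ) _).trans
      (add_le_add ((hgrid m).trans ?_) hexp)
    exact mul_le_mul_of_nonneg_left hWle
      (mul_nonneg (mul_nonneg gaussSqConst_nonneg (by positivity)) hΛ0)
  have hFlim (ω : Ω) : Tendsto (fun m => F m ω) atTop (nhds (∑ k ∈ K, a k *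
      (2 * (θ * ν k) * (∫ t in (0 : ℝ)..T, u k t ω ^ 2) + u k T ω ^ 2 - σ ^ 2 * q k ^ 2 * T))) := by
    refine tendsto_finsetSum _ fun k _ => Tendsto.const_mul _ ?_
    have h1 := tendsto_ar_sum hT (θ * ν k) (hcont k ω)
    have h2 := tendsto_mul_one_sub_exp_neg_div (2 * (θ * ν k) * T)
    have h3 := h1.add (h2.mul_const (1 - κ k))
    have hνk := hν k
    convert h3 using 2
    · rename_i m
      have e : r m k ^ 2 = rexp (-(2 * (θ * ν k) * T / m)) := by
        rw [hr, ← Real.exp_nat_mul]; congr 1; push_cast; ring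
      rw [← e]
      ring
    · rw [hκ]
      field_simp
      ring
  have hFmeas (m : ℕ) : AEMeasurable (F m) P := by
    refine Finset.aemeasurable_fun_sum _ fun k _ => AEMeasurable.const_mul ?_ _
    refine AEMeasurable.sub_const (AEMeasurable.add (AEMeasurable.const_mul
      (Finset.aemeasurable_fun_sum _ fun i hi => ?_) _) ?_) _
    · exact (h.aemeasurable k (mul_div_mem_Icc hT (Finset.mem_range.1 hi).le)).pow_const 2
    · exact (h.aemeasurable k (mul_div_mem_Icc hT le_rfl)).pow_const 2
  have hlim : Tendsto (fun m => ∫ ω, Complex.exp (((s * F m ω : ℝ) : ℂ) * Complex.I) ∂P) atTop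
      (nhds (∫ ω, Complex.exp (((s * ∑ k ∈ K, a k * (2 * (θ * ν k) *
        (∫ t in (0 : ℝ)..T, u k t ω ^ 2) + u k T ω ^ 2 - σ ^ 2 * q k ^ 2 * T) : ℝ) : ℂ)
          * Complex.I) ∂P)) := by
    refine tendsto_integral_of_dominated_convergence (fun _ => 1) (fun m => ?_)
      (integrable_const _) (fun m => ae_of_all _ fun ω => ?_) (ae_of_all _ fun ω => ?_)
    · have : Continuous fun x : ℝ => Complex.exp (((s * x : ℝ) : ℂ) * Complex.I) := by fun_prop
      exact (this.measurable.comp_aemeasurable (hFmeas m)).aestronglyMeasurable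
    · rw [Complex.norm_exp_ofReal_mul_I]
    · have : Continuous fun x : ℝ => Complex.exp (((s * x : ℝ) : ℂ) * Complex.I) := by fun_prop
      exact (this.tendsto _).comp (hFlim ω)
  have hexplim : Tendsto (fun m => (rexp (-(s ^ 2 * V m)) : ℂ)) atTop
      (nhds (rexp (-(s ^ 2 * V')) : ℂ)) :=
    (Complex.continuous_ofReal.tendsto _).comp
      ((Real.continuous_exp.tendsto _).comp (hVlim.const_mul _).neg)
  refine le_of_tendsto (hlim.sub hexplim).norm ?_
  filter_upwards [eventually_gt_atTop 0] with m hm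
  exact hbound m hm

lemma tendstoInDistribution_gaussianReal_of_tendsto_integral_exp {Ω : Type*} [MeasurableSpace Ω]
    {P : Measure Ω} [IsProbabilityMeasure P] {X : ℕ → Ω → ℝ} (v : NNReal)
    (hX : ∀ n, AEMeasurable (X n) P)
    (h : ∀ s : ℝ, Tendsto (fun n => ∫ ω, Complex.exp (((s * X n ω : ℝ) : ℂ) * Complex.I) ∂P) atTop
      (nhds (rexp (-(v * s ^ 2 / 2)) : ℂ))) :
    TendstoInDistribution X atTop id (fun _ => P) (gaussianReal 0 v) where
  forall_aemeasurable := hX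
  aemeasurable_limit := aemeasurable_id
  tendsto := by
    refine ProbabilityMeasure.tendsto_iff_tendsto_charFun.2 fun s => ?_
    simp only [ProbabilityMeasure.coe_mk, Measure.map_id, charFun_gaussianReal]
    convert h s using 2
    · rw [charFun_apply_real, integral_map (hX _) (by fun_prop)]
      push_cast
      rfl
    · push_cast
      simp

/-- A Slutsky-type argument for self-normalized ratios `c X / (1 + δ X - R)` with `X`
asymptotically Gaussian, `δ → 0` and `R → 0` in `L¹`. -/
lemma tendsto_integral_ratio {Ω : Type*} [MeasurableSpace Ω]
    {P : Measure Ω} [IsProbabilityMeasure P] {X R Q : ℕ → Ω → ℝ} {δ : ℕ → ℝ} (v : NNReal) (c : ℝ)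
    (hX : TendstoInDistribution X atTop id (fun _ => P) (gaussianReal 0 v))
    (hR0 : ∀ n ω, 0 ≤ R n ω) (hRi : ∀ n, Integrable (R n) P)
    (hR : Tendsto (fun n => ∫ ω, R n ω ∂P) atTop (nhds 0)) (hδ : Tendsto δ atTop (nhds 0))
    (hQm : ∀ n, AEMeasurable (Q n) P)
    (hQ : ∀ᶠ n in atTop, ∀ ω, 1 / 2 ≤ 1 + δ n * X n ω - R n ω →
      Q n ω = c * X n ω / (1 + δ n * X n ω - R n ω))
    (f : BoundedContinuousFunction ℝ ℝ) :
    Tendsto (fun n => ∫ ω, f (Q n ω) ∂P) atTop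
      (nhds (∫ y, f (c * y) ∂(gaussianReal 0 v))) := by
  have hY : TendstoInMeasure P (fun n ω => (δ n, R n ω)) atTop (fun _ => ((0 : ℝ), (0 : ℝ))) := by
    rw [tendstoInMeasure_iff_measureReal_norm]
    intro ε hε
    refine squeeze_zero' (Eventually.of_forall fun n => measureReal_nonneg) ?_
      (by simpa using hR.div_const ε)
    filter_upwards [hδ.abs.eventually_lt_const (by simpa using hε)] with n hn
    have h1 := mul_meas_ge_le_integral_of_nonneg (ae_of_all P (hR0 n)) (hRi n) ε
    rw [le_div_iff₀ hε, mul_comm]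
    refine le_trans (mul_le_mul_of_nonneg_left (measureReal_mono fun ω hω => ?_) hε.le) h1
    have hω' : ε ≤ max |δ n| |R n ω| := by simpa [Prod.norm_def] using hω
    rcases le_max_iff.1 hω' with h | h
    · exact absurd h (not_le.2 hn)
    · simpa [abs_of_nonneg (hR0 n ω)] using h
  have hYm (n : ℕ) : AEMeasurable (fun ω => (δ n, R n ω)) P :=
    aemeasurable_const.prodMk (hRi n).aemeasurable
  have hXm := hX.forall_aemeasurable
  have hg : Continuous fun p : ℝ × (ℝ × ℝ) => c * p.1 / max (1 + p.2.1 * p.1 - p.2.2) (1 / 2) := by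
    refine Continuous.div (by fun_prop) (by fun_prop) fun p => ?_
    exact (lt_of_lt_of_le (by norm_num) (le_max_right _ _)).ne'
  set φ : ℝ → ℝ := fun x => min 1 (max 0 (2 - 2 * x)) with hφ
  have hφc : Continuous φ := by fun_prop
  have hφ0 (x : ℝ) : 0 ≤ φ x := le_min zero_le_one (le_max_left _ _)
  have hφ1 (x : ℝ) : φ x ≤ 1 := min_le_left _ _
  have H1 := hX.continuous_comp_prodMk_of_tendstoInMeasure_const hg hY hYm
  have H2 := hX.continuous_comp_prodMk_of_tendstoInMeasure_const
    (g := fun p : ℝ × (ℝ × ℝ) => 1 + p.2.1 * p.1 - p.2.2) (by fun_prop) hY hYm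
  have L1 := ProbabilityMeasure.tendsto_iff_forall_integral_tendsto.1 H1.tendsto f
  have L2 := ProbabilityMeasure.tendsto_iff_forall_integral_tendsto.1 H2.tendsto
    (BoundedContinuousFunction.ofNormedAddCommGroup φ hφc 1 fun x => by
      rw [Real.norm_of_nonneg (hφ0 x)]; exact hφ1 x)
  simp only [ProbabilityMeasure.coe_mk, BoundedContinuousFunction.coe_ofNormedAddCommGroup] at L1 L2
  have e1 (n : ℕ) := integral_map (μ := P) (H1.forall_aemeasurable n) (f := f)
    f.continuous.aestronglyMeasurable
  have e2 (n : ℕ) := integral_map (μ := P) (H2.forall_aemeasurable n) (f := φ)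
    hφc.aestronglyMeasurable
  rw [integral_map H1.aemeasurable_limit f.continuous.aestronglyMeasurable] at L1
  rw [integral_map H2.aemeasurable_limit hφc.aestronglyMeasurable] at L2
  simp_rw [e1] at L1
  simp_rw [e2] at L2
  have hmax : max (1 : ℝ) (1 / 2) = 1 := by norm_num
  simp only [zero_mul, add_zero, sub_zero, hmax, div_one, id] at L1
  have hφ1' : φ 1 = 0 := by simp [hφ]
  simp only [zero_mul, add_zero, sub_zero, hφ1', integral_zero] at L2
  have hdiff : Tendsto (fun n => (∫ ω, f (Q n ω) ∂P) - ∫ ω, f (c * X n ω /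
      max (1 + δ n * X n ω - R n ω) (1 / 2)) ∂P) atTop (nhds 0) := by
    refine squeeze_zero_norm' ?_ (by simpa using L2.const_mul (2 * ‖f‖))
    filter_upwards [hQ] with n hn
    have i1 : Integrable (fun ω => f (Q n ω)) P :=
      Integrable.of_bound (f.continuous.measurable.comp_aemeasurable (hQm n)).aestronglyMeasurable
        ‖f‖ (ae_of_all _ fun ω => f.norm_coe_le_norm _)
    have i2 : Integrable (fun ω => f (c * X n ω / max (1 + δ n * X n ω - R n ω) (1 / 2))) P :=
      Integrable.of_bound (f.continuous.measurable.comp_aemeasurable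
        (H1.forall_aemeasurable n)).aestronglyMeasurable
        ‖f‖ (ae_of_all _ fun ω => f.norm_coe_le_norm _)
    have i3 : Integrable (fun ω => φ (1 + δ n * X n ω - R n ω)) P :=
      Integrable.of_bound (hφc.measurable.comp_aemeasurable
        (H2.forall_aemeasurable n)).aestronglyMeasurable
        1 (ae_of_all _ fun ω => by rw [Real.norm_of_nonneg (hφ0 _)]; exact hφ1 _)
    rw [← integral_sub i1 i2, ← integral_const_mul]
    refine norm_integral_le_of_norm_le (i3.const_mul _) (ae_of_all _ fun ω => ?_)
    rcases le_or_gt (1 / 2) (1 + δ n * X n ω - R n ω) with h | h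
    · rw [hn ω h, max_eq_left h, sub_self, norm_zero]
      exact mul_nonneg (by positivity) (hφ0 _)
    · have : φ (1 + δ n * X n ω - R n ω) = 1 := by
        refine min_eq_left (le_max_of_le_right ?_)
        linarith
      rw [this, mul_one, two_mul]
      exact (norm_sub_le _ _).trans (add_le_add (f.norm_coe_le_norm _) (f.norm_coe_le_norm _))
  simpa using hdiff.add L1

lemma sum_Icc_one_eq_sum_range (f : ℕ → ℝ) (N : ℕ) :
    ∑ k ∈ Finset.Icc 1 N, f k = ∑ k ∈ Finset.range N, f (k + 1) := by
  induction N with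
  | zero => simp
  | succ N ih => rw [Finset.sum_Icc_succ_top (by omega), ih, Finset.sum_range_succ]

lemma tendsto_sum_div_div_sum {g ν : ℕ → ℝ} (hg : ∀ k, 0 ≤ g k) (hν : Tendsto ν atTop atTop)
    (hsum : Tendsto (fun N : ℕ => ∑ k ∈ Finset.Icc 1 N, g k) atTop atTop) :
    Tendsto (fun N : ℕ => (∑ k ∈ Finset.Icc 1 N, g k / ν k) / ∑ k ∈ Finset.Icc 1 N, g k) atTop
      (nhds 0) := by
  simp_rw [sum_Icc_one_eq_sum_range] at hsum ⊢
  refine (Asymptotics.IsLittleO.sum_range ?_ (fun k => hg (k + 1)) hsum).tendsto_div_nhds_zero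
  have h1 : Tendsto (fun k => (ν (k + 1))⁻¹) atTop (nhds 0) :=
    tendsto_inv_atTop_zero.comp (hν.comp (tendsto_add_atTop_nat 1))
  have h2 := (Asymptotics.isBigO_refl (fun k => g (k + 1)) atTop).mul_isLittleO
    ((Asymptotics.isLittleO_one_iff ℝ).2 h1)
  simpa [div_eq_mul_inv] using h2

/-- Asymptotic normality of the estimator for general positive weights `a`. -/
lemma IsIndepOUFamily.tendsto_integral_estimator {Ω : Type*} [MeasurableSpace Ω] {P : Measure Ω}
    [IsProbabilityMeasure P]
    {u : ℕ → ℝ → Ω → ℝ} {θ σ : ℝ} {ν q : ℕ → ℝ} {T : ℝ} (h : IsIndepOUFamily P u θ σ ν q T)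
    (hθ : 0 < θ) (hσ : 0 < σ) (hT : 0 < T) (hν : ∀ k, 0 < ν k) (hq : ∀ k, 0 < q k)
    (hνlim : Tendsto ν atTop atTop)
    (hcont : ∀ k ω, ContinuousOn (fun t => u k t ω) (Set.Icc 0 T))
    {a : ℕ → ℝ} (ha : ∀ k, 0 < a k) {M : ℝ} (hM : ∀ k, 1 ≤ k → a k * q k ^ 2 / ν k ≤ M)
    (hA : Tendsto (fun N : ℕ => ∑ k ∈ Finset.Icc 1 N, a k * q k ^ 2) atTop atTop)
    (hB : Tendsto (fun N : ℕ => ∑ k ∈ Finset.Icc 1 N, a k ^ 2 * q k ^ 4 / ν k) atTop atTop)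
    (f : BoundedContinuousFunction ℝ ℝ) :
    Tendsto (fun N : ℕ => ∫ ω,
        f ((∑ k ∈ Finset.Icc 1 N, a k * q k ^ 2) /
            √(∑ k ∈ Finset.Icc 1 N, a k ^ 2 * q k ^ 4 / ν k) *
          (-(∑ k ∈ Finset.Icc 1 N, a k * (u k T ω ^ 2 - σ ^ 2 * q k ^ 2 * T)) /
            (2 * ∑ k ∈ Finset.Icc 1 N, ν k * a k * ∫ t in (0 : ℝ)..T, u k t ω ^ 2) - θ)) ∂P)
      atTop (nhds (∫ y, f y ∂(gaussianReal 0 (2 * θ / T).toNNReal))) := by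
  set A : ℕ → ℝ := fun N => ∑ k ∈ Finset.Icc 1 N, a k * q k ^ 2 with hAdef
  set B : ℕ → ℝ := fun N => ∑ k ∈ Finset.Icc 1 N, a k ^ 2 * q k ^ 4 / ν k with hBdef
  set S : ℕ → Ω → ℝ := fun N ω => ∑ k ∈ Finset.Icc 1 N, a k * (2 * (θ * ν k) *
    (∫ t in (0 : ℝ)..T, u k t ω ^ 2) + u k T ω ^ 2 - σ ^ 2 * q k ^ 2 * T) with hS
  set U : ℕ → Ω → ℝ := fun N ω => ∑ k ∈ Finset.Icc 1 N, a k * u k T ω ^ 2 with hU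
  have hTmem : T ∈ Set.Icc (0 : ℝ) T := ⟨hT.le, le_rfl⟩
  have huT (k : ℕ) : AEMeasurable (fun ω => u k T ω ^ 2) P :=
    (h.aemeasurable k hTmem).pow_const 2
  have hI (k : ℕ) := h.aemeasurable_integral_sq hT hcont k
  have hSm (N : ℕ) : AEMeasurable (S N) P :=
    Finset.aemeasurable_fun_sum _ fun k _ =>
      ((((hI k).const_mul _).add (huT k)).sub_const _).const_mul _
  have hM0 : 0 < M := lt_of_lt_of_le
    (div_pos (mul_pos (ha 1) (pow_pos (hq 1) 2)) (hν 1)) (hM 1 le_rfl)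
  have hApos : ∀ᶠ N in atTop, 0 < A N := hA.eventually_gt_atTop 0
  have hBpos : ∀ᶠ N in atTop, 0 < B N := hB.eventually_gt_atTop 0
  have hsqrtB : Tendsto (fun N => √(B N)) atTop atTop := tendsto_sqrt_atTop.comp hB
  set κ : ℕ → ℝ := fun k => σ ^ 2 * q k ^ 2 / (2 * θ * ν k) with hκ
  set V : ℝ := σ ^ 4 * T / θ with hV
  have hV0 : 0 ≤ V := by positivity
  -- asymptotic normality of the normalized numerator
  have hchar : TendstoInDistribution (fun N ω => S N ω / √(B N)) atTop id (fun _ => P)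
      (gaussianReal 0 (2 * V).toNNReal) := by
    refine tendstoInDistribution_gaussianReal_of_tendsto_integral_exp _
      (fun N => (hSm N).div_const _) fun s => ?_
    have hvV : ((2 * V).toNNReal : ℝ) * s ^ 2 / 2 = s ^ 2 * V := by
      rw [Real.coe_toNNReal _ (by positivity)]; ring
    rw [hvV]
    set Λ : ℕ → ℝ := fun N => 5 * (σ ^ 2 / (2 * θ) * M) / √(B N) with hΛ
    set D : ℕ → ℝ := fun N => σ ^ 4 / θ ^ 2 *
      ((∑ k ∈ Finset.Icc 1 N, (a k ^ 2 * q k ^ 4 / ν k) / ν k) / B N) with hD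
    have hΛlim : Tendsto Λ atTop (nhds 0) := hsqrtB.const_div_atTop _
    have hDlim : Tendsto D atTop (nhds 0) := by
      have := (tendsto_sum_div_div_sum (g := fun k => a k ^ 2 * q k ^ 4 / ν k)
        (fun k => by have := hν k; positivity) hνlim hB).const_mul (σ ^ 4 / θ ^ 2)
      simpa using this
    rw [tendsto_iff_norm_sub_tendsto_zero]
    have herr : Tendsto (fun N => gaussSqConst * |s| ^ 3 * Λ N * (V + D N) + s ^ 2 * D N) atTop
        (nhds 0) := by
      have := ((hΛlim.const_mul (gaussSqConst * |s| ^ 3)).mul (hDlim.const_add V)).add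
        (hDlim.const_mul (s ^ 2))
      simpa using this
    refine squeeze_zero' (Eventually.of_forall fun N => norm_nonneg _) ?_ herr
    filter_upwards [hBpos] with N hN
    have hb2 : √(B N) ^ 2 = B N := Real.sq_sqrt hN.le
    have hb0 : 0 < √(B N) := Real.sqrt_pos.2 hN
    have key := h.norm_integral_exp_sub_le hθ hT hν hcont (Finset.Icc 1 N)
      (fun k => a k / √(B N)) (fun k => div_nonneg (ha k).le hb0.le) (κ := κ) (fun k => rfl)
      (Λ := Λ N) (by positivity) (fun k hk => ?_) s
    · have e1 : ∑ k ∈ Finset.Icc 1 N, (a k / √(B N) * κ k) ^ 2 * (4 * (θ * ν k) * T) = V := by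
        have : ∀ k ∈ Finset.Icc 1 N, (a k / √(B N) * κ k) ^ 2 * (4 * (θ * ν k) * T)
            = V / B N * (a k ^ 2 * q k ^ 4 / ν k) := fun k _ => by
          have := hν k
          rw [mul_pow, div_pow, hb2, hκ, hV]
          field_simp
          ring
        rw [Finset.sum_congr rfl this, ← Finset.mul_sum]
        exact div_mul_cancel₀ V hN.ne'
      have e2 : ∑ k ∈ Finset.Icc 1 N, (a k / √(B N) * κ k) ^ 2 * 4 = D N := by
        rw [hD]
        simp only
        rw [← mul_div_assoc, Finset.mul_sum, Finset.sum_div]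
        refine Finset.sum_congr rfl fun k _ => ?_
        have := hν k
        rw [mul_pow, div_pow, hb2, hκ]
        field_simp
        ring
      have e3 (ω : Ω) : ∑ k ∈ Finset.Icc 1 N, a k / √(B N) * (2 * (θ * ν k) *
          (∫ t in (0 : ℝ)..T, u k t ω ^ 2) + u k T ω ^ 2 - σ ^ 2 * q k ^ 2 * T)
          = S N ω / √(B N) := by
        rw [hS, Finset.sum_div]
        exact Finset.sum_congr rfl fun k _ => by ring
      simp only [e1, e2, e3] at key
      exact key
    · have e : a k / √(B N) * κ k * 5 = 5 * (σ ^ 2 / (2 * θ) * (a k * q k ^ 2 / ν k)) / √(B N) := by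
        have := hν k
        rw [hκ]
        field_simp
      rw [e]
      have := hM k (Finset.mem_Icc.1 hk).1
      change _ ≤ 5 * (σ ^ 2 / (2 * θ) * M) / √(B N)
      gcongr
  -- the denominator
  set δ : ℕ → ℝ := fun N => √(B N) / (σ ^ 2 * T * A N) with hδ
  set R : ℕ → Ω → ℝ := fun N ω => U N ω / (σ ^ 2 * T * A N) with hR
  have hA0 (N : ℕ) : 0 ≤ A N := Finset.sum_nonneg fun k _ => mul_nonneg (ha k).le (sq_nonneg _)
  have hδlim : Tendsto δ atTop (nhds 0) := by
    refine squeeze_zero' (Eventually.of_forall fun N => div_nonneg (Real.sqrt_nonneg _)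
      (mul_nonneg (by positivity) (hA0 N))) ?_ (hsqrtB.const_div_atTop (M / (σ ^ 2 * T)))
    filter_upwards [hApos, hBpos] with N hAN hBN
    have hBA : B N ≤ M * A N := by
      rw [hBdef, hAdef, Finset.mul_sum]
      refine Finset.sum_le_sum fun k hk => ?_
      have h1 := hM k (Finset.mem_Icc.1 hk).1
      have h2 : 0 ≤ a k * q k ^ 2 := mul_nonneg (ha k).le (sq_nonneg _)
      calc a k ^ 2 * q k ^ 4 / ν k = a k * q k ^ 2 / ν k * (a k * q k ^ 2) := by ring
        _ ≤ M * (a k * q k ^ 2) := mul_le_mul_of_nonneg_right h1 h2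
    have hb0 : 0 < √(B N) := Real.sqrt_pos.2 hBN
    rw [div_div, div_le_div_iff₀ (by positivity) (by positivity)]
    have : √(B N) * √(B N) = B N := Real.mul_self_sqrt hBN.le
    calc √(B N) * (σ ^ 2 * T * √(B N)) = σ ^ 2 * T * (√(B N) * √(B N)) := by ring
      _ ≤ σ ^ 2 * T * (M * A N) := by rw [this]; gcongr
      _ = _ := by ring
  have hR0 (N : ℕ) (ω : Ω) : 0 ≤ R N ω :=
    div_nonneg (Finset.sum_nonneg fun k _ => mul_nonneg (ha k).le (sq_nonneg _))
      (mul_nonneg (by positivity) (hA0 N))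
  have hRi (N : ℕ) : Integrable (R N) P :=
    (integrable_finsetSum _ fun k _ => (h.integrable_sq k hTmem).const_mul _).div_const _
  have hRlim : Tendsto (fun N => ∫ ω, R N ω ∂P) atTop (nhds 0) := by
    have hc := (tendsto_sum_div_div_sum (g := fun k => a k * q k ^ 2)
      (fun k => mul_nonneg (ha k).le (sq_nonneg _)) hνlim hA).const_mul (1 / (2 * θ * T))
    rw [mul_zero] at hc
    refine squeeze_zero (fun N => integral_nonneg (hR0 N)) (fun N => ?_) hc
    have hUle : ∫ ω, U N ω ∂P ≤ σ ^ 2 / (2 * θ) * ∑ k ∈ Finset.Icc 1 N, a k * q k ^ 2 / ν k := by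
      rw [hU, integral_finsetSum _ fun k _ => (h.integrable_sq k hTmem).const_mul _,
        Finset.mul_sum]
      refine Finset.sum_le_sum fun k _ => ?_
      rw [integral_const_mul]
      refine (mul_le_mul_of_nonneg_left (h.integral_sq_le hθ hν k hTmem) (ha k).le).trans_eq ?_
      have := hν k
      field_simp
    rw [hR, integral_div]
    refine (div_le_div_of_nonneg_right hUle (mul_nonneg (by positivity) (hA0 N))).trans_eq ?_
    change _ = 1 / (2 * θ * T) * ((∑ k ∈ Finset.Icc 1 N, a k * q k ^ 2 / ν k) / A N)
    rcases (hA0 N).eq_or_lt with h0 | h0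
    · simp [← h0]
    · field_simp
  have hlim := tendsto_integral_ratio (2 * V).toNNReal (-(θ / (σ ^ 2 * T))) hchar hR0 hRi hRlim
    hδlim (Q := fun N ω => A N / √(B N) *
      (-(∑ k ∈ Finset.Icc 1 N, a k * (u k T ω ^ 2 - σ ^ 2 * q k ^ 2 * T)) /
        (2 * ∑ k ∈ Finset.Icc 1 N, ν k * a k * ∫ t in (0 : ℝ)..T, u k t ω ^ 2) - θ))
    (fun N => ?_) ?_ f
  · have hmap : gaussianReal 0 (2 * θ / T).toNNReal
        = (gaussianReal 0 (2 * V).toNNReal).map (fun y => -(θ / (σ ^ 2 * T)) * y) := by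
      rw [gaussianReal_map_const_mul]
      congr 1
      · simp
      · ext
        rw [NNReal.coe_mul, Real.coe_toNNReal _ (by positivity), Real.coe_toNNReal _ (by positivity)]
        simp only [NNReal.coe_mk]
        rw [hV]
        field_simp
    rw [hmap, integral_map (by fun_prop) f.continuous.aestronglyMeasurable]
    exact hlim
  · refine AEMeasurable.const_mul (AEMeasurable.sub_const (AEMeasurable.div ?_ ?_) _) _
    · exact (Finset.aemeasurable_fun_sum _ fun k _ => ((huT k).sub_const _).const_mul _).neg
    · exact (Finset.aemeasurable_fun_sum _ fun k _ => (hI k).const_mul _).const_mul _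
  · filter_upwards [hApos, hBpos] with N hAN hBN ω hω
    have hb0 : 0 < √(B N) := Real.sqrt_pos.2 hBN
    have hnum : ∑ k ∈ Finset.Icc 1 N, a k * (u k T ω ^ 2 - σ ^ 2 * q k ^ 2 * T)
        = U N ω - σ ^ 2 * T * A N := by
      rw [hU, hAdef, Finset.mul_sum, ← Finset.sum_sub_distrib]
      exact Finset.sum_congr rfl fun k _ => by ring
    have hSeq : S N ω = 2 * θ * (∑ k ∈ Finset.Icc 1 N, ν k * a k *
        ∫ t in (0 : ℝ)..T, u k t ω ^ 2) + U N ω - σ ^ 2 * T * A N := by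
      rw [hS, hU, hAdef, Finset.mul_sum, Finset.mul_sum, ← Finset.sum_add_distrib,
        ← Finset.sum_sub_distrib]
      exact Finset.sum_congr rfl fun k _ => by ring
    set I := ∑ k ∈ Finset.Icc 1 N, ν k * a k * ∫ t in (0 : ℝ)..T, u k t ω ^ 2 with hIdef
    have hden : 1 + δ N * (S N ω / √(B N)) - R N ω = 2 * θ * I / (σ ^ 2 * T * A N) := by
      rw [hδ, hR, hSeq]
      field_simp
      ring
    rw [hden] at hω ⊢
    have hI0 : I ≠ 0 := by
      intro h0
      rw [h0] at hω
      norm_num at hω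
    rw [hnum, hSeq]
    field_simp
    ring

/-- Asymptotic normality of the modified MLE in the spectral approach: the normalized
errors converge in distribution to `N(0, 2θ/T)` (weak convergence tested against bounded
continuous functions). -/
theorem stmt1 {Ω : Type*} [MeasurableSpace Ω] (P : Measure Ω) [IsProbabilityMeasure P]
    (θ σ T α ρ : ℝ) (hθ : 0 < θ) (hσ : 0 < σ) (hT : 0 < T)
    (ν q : ℕ → ℝ) (hν : ∀ k, 0 < ν k) (hq : ∀ k, 0 < q k)
    (hνlim : Tendsto ν atTop atTop) (hqlim : Tendsto q atTop (nhds 0))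
    (M : ℝ) (hM : ∀ n, 1 ≤ n → ν n ^ (α - 1) * q n ^ (2 * ρ + 2) ≤ M)
    (hdiv : Tendsto (fun N : ℕ => ∑ k ∈ Finset.Icc 1 N, ν k ^ α * q k ^ (2 * ρ + 2))
      atTop atTop)
    (hdiv2 : Tendsto (fun N : ℕ => ∑ k ∈ Finset.Icc 1 N, ν k ^ (2 * α - 1) * q k ^ (4 * ρ + 4))
      atTop atTop)
    (u : ℕ → ℝ → Ω → ℝ)
    (hcont : ∀ k ω, ContinuousOn (fun t => u k t ω) (Set.Icc 0 T))
    (hOU : IsIndepOUFamily P u θ σ ν q T) :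
    ∀ f : BoundedContinuousFunction ℝ ℝ,
      Tendsto (fun N : ℕ => ∫ ω,
          f ((∑ k ∈ Finset.Icc 1 N, ν k ^ α * q k ^ (2 * ρ + 2)) /
              Real.sqrt (∑ k ∈ Finset.Icc 1 N, ν k ^ (2 * α - 1) * q k ^ (4 * ρ + 4)) *
            (-(∑ k ∈ Finset.Icc 1 N, ν k ^ α * q k ^ (2 * ρ) *
                  ((u k T ω) ^ 2 - σ ^ 2 * q k ^ 2 * T)) /
                (2 * ∑ k ∈ Finset.Icc 1 N, ν k ^ (1 + α) * q k ^ (2 * ρ) *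
                  ∫ t in (0 : ℝ)..T, (u k t ω) ^ 2) - θ)) ∂P)
        atTop (nhds (∫ y, f y ∂(gaussianReal 0 (2 * θ / T).toNNReal))) := by
  have hqa (k : ℕ) : q k ^ (2 * ρ + 2) = q k ^ (2 * ρ) * q k ^ 2 := by
    rw [Real.rpow_add (hq k), Real.rpow_two]
  have hA (k : ℕ) : ν k ^ α * q k ^ (2 * ρ + 2) = ν k ^ α * q k ^ (2 * ρ) * q k ^ 2 := by
    rw [hqa, mul_assoc]
  have hB (k : ℕ) : ν k ^ (2 * α - 1) * q k ^ (4 * ρ + 4)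
      = (ν k ^ α * q k ^ (2 * ρ)) ^ 2 * q k ^ 4 / ν k := by
    have e1 : ν k ^ (2 * α - 1) = (ν k ^ α) ^ 2 / ν k := by
      rw [Real.rpow_sub (hν k), Real.rpow_one, two_mul, Real.rpow_add (hν k), sq]
    have e2 : q k ^ (4 * ρ + 4) = (q k ^ (2 * ρ)) ^ 2 * q k ^ 4 := by
      rw [show 4 * ρ + 4 = (2 * ρ + 2) + (2 * ρ + 2) by ring, Real.rpow_add (hq k), hqa]
      ring
    rw [e1, e2]
    ring
  have hD (k : ℕ) : ν k ^ (1 + α) * q k ^ (2 * ρ) = ν k * (ν k ^ α * q k ^ (2 * ρ)) := by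
    rw [Real.rpow_add (hν k), Real.rpow_one, mul_assoc]
  have hM' (k : ℕ) (hk : 1 ≤ k) : ν k ^ α * q k ^ (2 * ρ) * q k ^ 2 / ν k ≤ M := by
    refine le_trans (le_of_eq ?_) (hM k hk)
    rw [Real.rpow_sub (hν k), Real.rpow_one, hqa]
    ring
  simp only [hA, hB, hD] at hdiv hdiv2 ⊢
  exact hOU.tendsto_integral_estimator hθ hσ hT hν hq hνlim hcont
    (fun k => mul_pos (Real.rpow_pos_of_pos (hν k) _) (Real.rpow_pos_of_pos (hq k) _))
    hM' hdiv hdiv2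
end
end

section
/- Let θ, σ, T > 0, α, ρ ∈ ℝ, and let (ν_k)_{k≥1}, (q_k)_{k≥1} be positive sequences with ν_k → ∞ and q_k → 0. Assume there exists M ∈ ℝ with ν_n^{α−1} q_n^{2ρ+2} ≤ M for all n, and Σ_{k≥1} ν_k^{α} q_k^{2ρ+2} = ∞. Define b_n := Σ_{k=1}^n (σ²/(2θ)) ν_k^{α} q_k^{2ρ+2} ( T − (1 − e^{−2θν_kT})/(2θν_k) ) and W_n := (σ⁴/(2θ)) ν_n^{2α−1} q_n^{4ρ+4} ( T − (1 − e^{−2θν_nT})/(2θν_n) ). Then Σ_{n≥1} W_n / b_n² < ∞. -/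
open MeasureTheory Real Filter

noncomputable section

/-- For a positive monotone sequence `s`, the increments divided by `s ^ 2` are summable. -/
theorem summable_increment_div_sq {s : ℕ → ℝ} (hpos : ∀ n, 0 < s n) (hmono : Monotone s) :
    Summable (fun n => (s (n + 1) - s n) / s (n + 1) ^ 2) := by
  refine summable_of_sum_range_le (c := (s 0)⁻¹)
    (fun n => div_nonneg (sub_nonneg.2 (hmono n.le_succ)) (sq_nonneg _)) fun n => ?_
  have step (k : ℕ) : (s (k + 1) - s k) / s (k + 1) ^ 2 ≤ (s k)⁻¹ - (s (k + 1))⁻¹ := by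
    have h0 := hpos k
    have h1 := hpos (k + 1)
    have hle : s k ≤ s (k + 1) := hmono k.le_succ
    rw [inv_sub_inv h0.ne' h1.ne']
    exact div_le_div_of_nonneg_left (sub_nonneg.2 hle) (by positivity) (by nlinarith)
  calc ∑ k ∈ Finset.range n, (s (k + 1) - s k) / s (k + 1) ^ 2
      ≤ ∑ k ∈ Finset.range n, ((s k)⁻¹ - (s (k + 1))⁻¹) := Finset.sum_le_sum fun k _ => step k
    _ = (s 0)⁻¹ - (s n)⁻¹ := Finset.sum_range_sub' (fun k => (s k)⁻¹) n
    _ ≤ (s 0)⁻¹ := sub_le_self _ (inv_nonneg.2 (hpos n).le)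

theorem sub_one_sub_exp_neg_mul_div_pos {c T : ℝ} (hc : 0 < c) (hT : 0 < T) :
    0 < T - (1 - Real.exp (-(c * T))) / c := by
  have hexp := Real.add_one_lt_exp (neg_ne_zero.2 (mul_pos hc hT).ne')
  rw [sub_pos, div_lt_iff₀ hc]
  linarith

/-- The series condition `Σ_n Var(ξ_n)/b_n² < ∞` verified in the proof of consistency
of the spectral MLE. -/
theorem stmt5 (θ σ T α ρ : ℝ) (hθ : 0 < θ) (hσ : 0 < σ) (hT : 0 < T)
    (ν q : ℕ → ℝ) (hν : ∀ k, 0 < ν k) (hq : ∀ k, 0 < q k)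
    (hνlim : Tendsto ν atTop atTop) (hqlim : Tendsto q atTop (nhds 0))
    (M : ℝ) (hM : ∀ n, 1 ≤ n → ν n ^ (α - 1) * q n ^ (2 * ρ + 2) ≤ M)
    (hdiv : Tendsto (fun N : ℕ => ∑ k ∈ Finset.Icc 1 N, ν k ^ α * q k ^ (2 * ρ + 2))
      atTop atTop)
    (b W : ℕ → ℝ)
    (hb : ∀ n, b n = ∑ k ∈ Finset.Icc 1 n, (σ ^ 2 / (2 * θ)) * ν k ^ α * q k ^ (2 * ρ + 2) *
      (T - (1 - Real.exp (-(2 * θ * ν k * T))) / (2 * θ * ν k)))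
    (hW : ∀ n, W n = (σ ^ 4 / (2 * θ)) * ν n ^ (2 * α - 1) * q n ^ (4 * ρ + 4) *
      (T - (1 - Real.exp (-(2 * θ * ν n * T))) / (2 * θ * ν n))) :
    Summable (fun n : ℕ => W (n + 1) / b (n + 1) ^ 2) := by
  set a : ℕ → ℝ := fun k => (σ ^ 2 / (2 * θ)) * ν k ^ α * q k ^ (2 * ρ + 2) *
    (T - (1 - Real.exp (-(2 * θ * ν k * T))) / (2 * θ * ν k)) with ha
  have ha_pos (k : ℕ) : 0 < a k := by
    have hν' := hν k
    have hq' := hq k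
    have := sub_one_sub_exp_neg_mul_div_pos (c := 2 * θ * ν k) (by positivity) hT
    simp only [ha]
    positivity
  have hb_succ (n : ℕ) : b (n + 1) = b n + a (n + 1) := by
    rw [hb, hb, Finset.sum_Icc_succ_top (Nat.le_add_left 1 n)]
  have hb_pos (n : ℕ) : 0 < b (n + 1) := by
    rw [hb]
    exact Finset.sum_pos (fun k _ => ha_pos k) ⟨1, by simp⟩
  have hW_eq (n : ℕ) : W n = σ ^ 2 * (ν n ^ (α - 1) * q n ^ (2 * ρ + 2)) * a n := by
    have h1 : ν n ^ (2 * α - 1) = ν n ^ (α - 1) * ν n ^ α := by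
      rw [← Real.rpow_add (hν n)]
      ring_nf
    have h2 : q n ^ (4 * ρ + 4) = q n ^ (2 * ρ + 2) * q n ^ (2 * ρ + 2) := by
      rw [← Real.rpow_add (hq n)]
      ring_nf
    rw [hW, h1, h2]
    simp only [ha]
    ring
  have hsum := summable_increment_div_sq hb_pos
    (monotone_nat_of_le_succ fun n => by
      rw [hb_succ (n + 1)]
      exact le_add_of_nonneg_right (ha_pos _).le)
  rw [← summable_nat_add_iff 1]
  refine Summable.of_nonneg_of_le (fun n => ?_) (fun n => ?_) (hsum.mul_left (σ ^ 2 * M))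
  · have hν' := hν (n + 1 + 1)
    have hq' := hq (n + 1 + 1)
    have ha' := ha_pos (n + 1 + 1)
    rw [hW_eq]
    positivity
  · rw [hW_eq, hb_succ (n + 1), add_sub_cancel_left, ← mul_div_assoc]
    have ha' := (ha_pos (n + 1 + 1)).le
    have hM' := hM (n + 1 + 1) (Nat.le_add_left 1 _)
    gcongr
end
end
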